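/- arXiv:1311.2337 — 2 statements merged into one kernel-verified Lean document; each statement's English description precedes it below -/
import Mathlib

section
/- For every ε ∈ (0,1) and every P ∈ (0,∞), there exist a constant c > 0 and N ∈ ℕ such that for all n ≥ N, |log M*(Wⁿ, ε, P) − (n·C(P) + √(n·V(P))·Φ⁻¹(ε) + (1/2)·log n)| ≤ c; that is, log M*(Wⁿ,ε,P) = n·C(P) + √(n·V(P))·Φ⁻¹(ε) + (1/2)·log n + O(1). -/
open MeasureTheory ProbabilityTheory Real
open scoped ENNReal

noncomputable section

/-- Gaussian capacity `C(P) = (1/2) log(1+P)` (natural logarithm). -/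
def gaussC (P : ℝ) : ℝ := Real.log (1 + P) / 2

/-- Gaussian dispersion `V(P) = P(P+2)/(2(P+1)^2)` (in nats). -/
def gaussV (P : ℝ) : ℝ := P * (P + 2) / (2 * (P + 1) ^ 2)

/-- Standard normal cumulative distribution function. -/
def Phi (a : ℝ) : ℝ := ∫ u in Set.Iic a, (Real.sqrt (2 * π))⁻¹ * Real.exp (-u ^ 2 / 2)

/-- Inverse of the standard normal CDF, `Φ⁻¹(ε) = sup {a : Φ(a) ≤ ε}`. -/
def PhiInv (ε : ℝ) : ℝ := sSup {a : ℝ | Phi a ≤ ε}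

/-- The `n`-fold AWGN channel with unit noise variance: `Wn n x D` is the probability
that `x + Z ∈ D` where `Z` is an i.i.d. standard Gaussian vector. -/
def Wn (n : ℕ) (x : Fin n → ℝ) (D : Set (Fin n → ℝ)) : ℝ≥0∞ :=
  (Measure.pi fun _ : Fin n => gaussianReal 0 1) {z | (fun i => x i + z i) ∈ D}

/-- Existence of an `(n, M, ε, P)_av`-code: `M` codewords satisfying the maximal power
constraint `‖x(m)‖₂² ≤ nP`, with pairwise disjoint measurable decoding regions and
average error probability at most `ε`. -/
def IsCode (n M : ℕ) (ε P : ℝ) : Prop :=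
  ∃ (x : Fin M → Fin n → ℝ) (D : Fin M → Set (Fin n → ℝ)),
    (∀ m, ∑ i, x m i ^ 2 ≤ n * P) ∧
    (∀ m, MeasurableSet (D m)) ∧
    (∀ m m', m ≠ m' → Disjoint (D m) (D m')) ∧
    (1 / M : ℝ) * ∑ m, (Wn n (x m) (D m)ᶜ).toReal ≤ ε

/-- `M*(Wⁿ, ε, P)`: maximal size of an `(n, M, ε, P)_av`-code. -/
def Mstar (n : ℕ) (ε P : ℝ) : ℕ := sSup {M : ℕ | IsCode n M ε P}

/-- The standard normal density. -/
def normalPDF (a : ℝ) : ℝ := (Real.sqrt (2 * π))⁻¹ * Real.exp (-a ^ 2 / 2)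

lemma normalPDF_eq (a : ℝ) : normalPDF a = gaussianPDFReal 0 1 a := by
  simp [normalPDF, gaussianPDFReal]

lemma normalPDF_pos (a : ℝ) : 0 < normalPDF a := by
  unfold normalPDF; positivity

lemma inv_sqrt_two_pi_le_one : (Real.sqrt (2 * π))⁻¹ ≤ 1 := by
  apply inv_le_one_of_one_le₀
  rw [Real.one_le_sqrt]
  linarith [Real.pi_gt_three]

lemma normalPDF_le_one (a : ℝ) : normalPDF a ≤ 1 := by
  unfold normalPDF
  apply mul_le_one₀ inv_sqrt_two_pi_le_one (exp_pos _).le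
  rw [Real.exp_le_one_iff]
  nlinarith [sq_nonneg a]

lemma continuous_normalPDF : Continuous normalPDF := by
  unfold normalPDF; fun_prop

lemma integrable_normalPDF : Integrable normalPDF := by
  have : normalPDF = gaussianPDFReal 0 1 := funext normalPDF_eq
  rw [this]; exact integrable_gaussianPDFReal 0 1

lemma Phi_eq_measureReal (a : ℝ) : Phi a = (gaussianReal 0 1).real (Set.Iic a) := by
  rw [measureReal_def, gaussianReal_apply_eq_integral _ one_ne_zero, ENNReal.toReal_ofReal]
  · unfold Phi
    exact integral_congr_ae (.of_forall fun x => normalPDF_eq x)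
  · exact integral_nonneg fun x => gaussianPDFReal_nonneg _ _ _

lemma Phi_nonneg (a : ℝ) : 0 ≤ Phi a := by
  rw [Phi_eq_measureReal]; exact measureReal_nonneg

lemma Phi_le_one (a : ℝ) : Phi a ≤ 1 := by
  rw [Phi_eq_measureReal]; exact measureReal_le_one

lemma Phi_mono : Monotone Phi := by
  intro a b h
  rw [Phi_eq_measureReal, Phi_eq_measureReal]
  exact measureReal_mono (Set.Iic_subset_Iic.2 h)

lemma hasDerivAt_Phi (a : ℝ) : HasDerivAt Phi (normalPDF a) a := by
  have h : Phi = fun b => Phi 0 + ∫ u in (0 : ℝ)..b, normalPDF u := by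
    funext b
    have := intervalIntegral.integral_Iic_sub_Iic (μ := volume) (f := normalPDF) (a := 0) (b := b)
      integrable_normalPDF.integrableOn integrable_normalPDF.integrableOn
    rw [← this]
    simp [Phi, normalPDF]
  rw [h]
  exact (intervalIntegral.integral_hasDerivAt_right
    (integrable_normalPDF.intervalIntegrable)
    (continuous_normalPDF.stronglyMeasurableAtFilter _ _)
    continuous_normalPDF.continuousAt).const_add _

lemma continuous_Phi : Continuous Phi :=
  continuous_iff_continuousAt.2 fun a => (hasDerivAt_Phi a).continuousAt

lemma Phi_strictMono : StrictMono Phi :=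
  strictMono_of_deriv_pos fun a => by rw [(hasDerivAt_Phi a).deriv]; exact normalPDF_pos a

lemma tendsto_Phi_atTop : Filter.Tendsto Phi Filter.atTop (nhds 1) := by
  have : Phi = fun a => cdf (gaussianReal 0 1) a := by
    funext a; rw [Phi_eq_measureReal, cdf_eq_real]
  rw [this]; exact tendsto_cdf_atTop _

lemma tendsto_Phi_atBot : Filter.Tendsto Phi Filter.atBot (nhds 0) := by
  have : Phi = fun a => cdf (gaussianReal 0 1) a := by
    funext a; rw [Phi_eq_measureReal, cdf_eq_real]
  rw [this]; exact tendsto_cdf_atBot _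

lemma Phi_PhiInv {ε : ℝ} (hε : ε ∈ Set.Ioo (0 : ℝ) 1) : Phi (PhiInv ε) = ε := by
  obtain ⟨l, hl⟩ := (tendsto_Phi_atBot.eventually (gt_mem_nhds hε.1)).exists
  obtain ⟨r, hr⟩ := (tendsto_Phi_atTop.eventually (lt_mem_nhds hε.2)).exists
  obtain ⟨m, hm⟩ := mem_range_of_exists_le_of_exists_ge continuous_Phi ⟨l, hl.le⟩ ⟨r, hr.le⟩
  have : {a : ℝ | Phi a ≤ ε} = Set.Iic m := by
    ext a
    simp [← hm, Phi_strictMono.le_iff_le]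
  rw [PhiInv, this, csSup_Iic, hm]

lemma exists_Phi_slope (m : ℝ) : ∃ c > 0, ∀ a b, m - 1 ≤ a → a ≤ b → b ≤ m + 1 →
    c * (b - a) ≤ Phi b - Phi a := by
  refine ⟨normalPDF (|m| + 1), normalPDF_pos _, fun a b ha hab hb => ?_⟩
  refine Convex.mul_sub_le_image_sub_of_le_deriv (f := Phi) (D := Set.Icc (m - 1) (m + 1))
    (convex_Icc _ _)
    continuous_Phi.continuousOn
    (fun x _ => (hasDerivAt_Phi x).differentiableAt.differentiableWithinAt)
    (fun x hx => ?_) a ⟨ha, by linarith⟩ b ⟨by linarith, hb⟩ hab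
  rw [(hasDerivAt_Phi x).deriv]
  rw [interior_Icc] at hx
  unfold normalPDF
  have : |x| ≤ |m| + 1 := by
    rw [abs_le]; constructor
    · linarith [neg_abs_le m, hx.1]
    · linarith [le_abs_self m, hx.2]
  have h2 : x ^ 2 ≤ (|m| + 1) ^ 2 := by
    rw [← sq_abs x]
    gcongr
  gcongr

/-- Second-order Taylor expansion with a cubic remainder. -/
lemma abs_taylor_two_le {f f₁ f₂ f₃ : ℝ → ℝ} {K : ℝ} (h₁ : ∀ x, HasDerivAt f (f₁ x) x)
    (h₂ : ∀ x, HasDerivAt f₁ (f₂ x) x) (h₃ : ∀ x, HasDerivAt f₂ (f₃ x) x) (hK : ∀ x, |f₃ x| ≤ K)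
    (a x : ℝ) : |f (a + x) - f a - f₁ a * x - f₂ a / 2 * x ^ 2| ≤ K * |x| ^ 3 := by
  have hK0 : 0 ≤ K := (abs_nonneg _).trans (hK 0)
  have key : ∀ (g g' : ℝ → ℝ) (C : ℝ), (∀ y, HasDerivAt g (g' y) y) →
      (∀ y, |y| ≤ |x| → |g' y| ≤ C) → ∀ y, |y| ≤ |x| → |g y - g 0| ≤ C * |y| := by
    intro g g' C hg hC y hy
    have := Convex.norm_image_sub_le_of_norm_hasDerivWithin_le (f := g) (f' := g')
      (s := Set.Icc (-|x|) |x|) (C := C) (fun z _ => (hg z).hasDerivWithinAt)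
      (fun z hz => hC z (abs_le.2 hz)) (convex_Icc _ _) (x := 0) (y := y)
      ⟨by simp, by simp⟩ (abs_le.1 hy)
    simpa using this
  have e2 : ∀ y, |y| ≤ |x| → |f₂ (a + y) - f₂ a| ≤ K * |x| := by
    intro y hy
    have := key (fun y => f₂ (a + y)) (fun y => f₃ (a + y)) K
      (fun y => (h₃ (a + y)).comp_const_add a y) (fun y _ => hK _) y hy
    simp only [add_zero] at this
    exact this.trans (by gcongr)
  have e1 : ∀ y, |y| ≤ |x| → |f₁ (a + y) - f₁ a - f₂ a * y| ≤ K * |x| * |x| := by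
    intro y hy
    have := key (fun y => f₁ (a + y) - f₂ a * y) (fun y => f₂ (a + y) - f₂ a) (K * |x|)
      (fun y => (((h₂ (a + y)).comp_const_add a y).fun_sub
        ((hasDerivAt_id' y).const_mul (f₂ a))).congr_deriv (by ring))
      e2 y hy
    simp only [add_zero, mul_zero, sub_zero] at this
    have h' : |f₁ (a + y) - f₁ a - f₂ a * y| ≤ K * |x| * |y| := by
      convert this using 2; ring
    exact h'.trans (by gcongr)
  have := key (fun y => f (a + y) - f₁ a * y - f₂ a / 2 * y ^ 2)
      (fun y => f₁ (a + y) - f₁ a - f₂ a * y) (K * |x| * |x|)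
      (fun y => by
        have := (((h₁ (a + y)).comp_const_add a y).fun_sub
          ((hasDerivAt_id' y).const_mul (f₁ a))).fun_sub
          (((hasDerivAt_id' y).fun_pow 2).const_mul (f₂ a / 2))
        exact this.congr_deriv (by push_cast; ring))
      e1 x le_rfl
  simp only [add_zero, mul_zero, sub_zero] at this
  calc _ = _ := by congr 1; ring_nf
    _ ≤ _ := this
    _ = _ := by ring

lemma Phi_taylor (a x : ℝ) :
    |Phi (a + x) - Phi a - normalPDF a * x - (-a * normalPDF a) / 2 * x ^ 2| ≤ |x| ^ 3 := by
  have hd : ∀ a, HasDerivAt normalPDF (-a * normalPDF a) a := by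
    intro a
    unfold normalPDF
    have := ((((hasDerivAt_id' a).fun_pow 2).fun_neg.div_const 2).exp).const_mul (Real.sqrt (2 * π))⁻¹
    exact this.congr_deriv (by push_cast; ring)
  have hd2 : ∀ a, HasDerivAt (fun a => -a * normalPDF a) ((a ^ 2 - 1) * normalPDF a) a := by
    intro a
    have := ((hasDerivAt_id' a).fun_neg).fun_mul (hd a)
    exact this.congr_deriv (by ring)
  have := abs_taylor_two_le (K := 1) hasDerivAt_Phi hd hd2 (fun a => ?_) a x
  · simpa using this
  rw [abs_mul, abs_of_pos (normalPDF_pos a)]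
  have h1 : |a ^ 2 - 1| ≤ Real.exp (a ^ 2 / 2) := by
    have := Real.quadratic_le_exp_of_nonneg (x := a ^ 2 / 2) (by positivity)
    rw [abs_le]; constructor <;> nlinarith [sq_nonneg a, sq_nonneg (a ^ 2 / 2 - 1)]
  calc |a ^ 2 - 1| * normalPDF a ≤ Real.exp (a ^ 2 / 2) * normalPDF a := by
        gcongr; exact (normalPDF_pos a).le
    _ = (Real.sqrt (2 * π))⁻¹ := by
        unfold normalPDF
        rw [mul_left_comm, ← Real.exp_add]
        simp [neg_div]
    _ ≤ 1 := inv_sqrt_two_pi_le_one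

/-- The chi-squared distribution with `k` degrees of freedom. -/
def chiSq (k : ℕ) : Measure ℝ :=
  (Measure.pi fun _ : Fin k => gaussianReal 0 1).map fun w => ∑ i, w i ^ 2

instance isProbabilityMeasure_chiSq (k : ℕ) : IsProbabilityMeasure (chiSq k) :=
  Measure.isProbabilityMeasure_map (Measurable.aemeasurable (by fun_prop))

lemma chiSq_zero : chiSq 0 = Measure.dirac 0 := by
  simp [chiSq, Measure.map_const]

lemma map_sum_eq_map_prod_chiSq {α : Type*} [MeasurableSpace α] {k : ℕ} {F : ℝ × ℝ → α}
    (hF : Measurable F) :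
    (Measure.pi fun _ : Fin (k + 1) => gaussianReal 0 1).map
      (fun z => F (z 0, ∑ i : Fin k, z i.succ ^ 2)) =
    ((gaussianReal 0 1).prod (chiSq k)).map F := by
  have h := measurePreserving_piFinSuccAbove (fun _ : Fin (k + 1) => gaussianReal 0 1) 0
  have h2 : (gaussianReal 0 1).prod (chiSq k) =
      ((gaussianReal 0 1).prod (Measure.pi fun _ : Fin k => gaussianReal 0 1)).map
        (Prod.map id fun w => ∑ i, w i ^ 2) := by
    rw [chiSq, ← Measure.map_prod_map _ _ measurable_id (by fun_prop), Measure.map_id]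
  rw [h2, ← h.map_eq, Measure.map_map (by fun_prop) (MeasurableEquiv.measurable _),
    Measure.map_map hF (by
      apply Measurable.comp (by fun_prop) (MeasurableEquiv.measurable _))]
  rfl

lemma chiSq_succ (k : ℕ) :
    chiSq (k + 1) = ((gaussianReal 0 1).prod (chiSq k)).map (fun p => p.1 ^ 2 + p.2) := by
  rw [← map_sum_eq_map_prod_chiSq (by fun_prop), chiSq]
  simp_rw [Fin.sum_univ_succ]

lemma ae_chiSq_nonneg (k : ℕ) : ∀ᵐ q ∂(chiSq k), 0 ≤ q := by
  rw [chiSq, ae_map_iff (Measurable.aemeasurable (by fun_prop)) measurableSet_Ici]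
  exact .of_forall fun w => Finset.sum_nonneg fun i _ => sq_nonneg _

lemma lintegral_chiSq_succ (k : ℕ) {f : ℝ → ℝ≥0∞} (hf : Measurable f) :
    ∫⁻ q, f q ∂(chiSq (k + 1)) = ∫⁻ w, ∫⁻ q, f (w ^ 2 + q) ∂(chiSq k) ∂(gaussianReal 0 1) := by
  rw [chiSq_succ, lintegral_map hf (by fun_prop), lintegral_prod _ (by fun_prop)]

lemma measurable_Phi : Measurable Phi := continuous_Phi.measurable

lemma integrable_Phi_comp {α : Type*} [MeasurableSpace α] {ν : Measure α} [IsFiniteMeasure ν]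
    {F : α → ℝ} (hF : Measurable F) : Integrable (fun q => Phi (F q)) ν := by
  refine Integrable.of_bound (measurable_Phi.comp hF).aestronglyMeasurable 1 (.of_forall fun q => ?_)
  rw [Real.norm_eq_abs, abs_of_nonneg (Phi_nonneg _)]
  exact Phi_le_one _

lemma integral_chiSq_succ_Phi (k : ℕ) {F : ℝ → ℝ} (hF : Measurable F) :
    ∫ q, Phi (F q) ∂(chiSq (k + 1)) =
      ∫ w, ∫ q, Phi (F (w ^ 2 + q)) ∂(chiSq k) ∂(gaussianReal 0 1) := by
  rw [chiSq_succ, integral_map (f := fun q => Phi (F q)) (by fun_prop)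
    (measurable_Phi.comp hF).aestronglyMeasurable, integral_prod]
  exact integrable_Phi_comp (hF.comp (by fun_prop))

lemma measureReal_prod_le_eq_integral_Phi {α : Type*} [MeasurableSpace α] {ν : Measure α}
    [IsProbabilityMeasure ν] {F : α → ℝ} (hF : Measurable F) :
    ((gaussianReal 0 1).prod ν).real {p | p.1 ≤ F p.2} = ∫ q, Phi (F q) ∂ν := by
  have hm : MeasurableSet {p : ℝ × α | p.1 ≤ F p.2} :=
    measurableSet_le measurable_fst (hF.comp measurable_snd)
  rw [measureReal_def, Measure.prod_apply_symm hm, ← integral_toReal]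
  · congr 1; ext q
    rw [Phi_eq_measureReal, measureReal_def]
    rfl
  · exact (measurable_measure_prodMk_right hm).aemeasurable
  · exact .of_forall fun q => measure_lt_top _ _

lemma integral_Phi_gaussian (a c : ℝ) :
    ∫ w, Phi (a + c * w) ∂(gaussianReal 0 1) = Phi (a / Real.sqrt (1 + c ^ 2)) := by
  rw [← measureReal_prod_le_eq_integral_Phi (by fun_prop)]
  have hpos : 0 < Real.sqrt (1 + c ^ 2) := by positivity
  have h1 : gaussianReal 0 1 ∗ (gaussianReal 0 1).map (-c * ·) =
      (gaussianReal 0 1).map (Real.sqrt (1 + c ^ 2) * ·) := by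
    rw [gaussianReal_map_const_mul, gaussianReal_map_const_mul, gaussianReal_conv_gaussianReal]
    congr 1
    · simp
    · ext
      simp [Real.sq_sqrt (show (0 : ℝ) ≤ 1 + c ^ 2 by positivity)]
  have h2 := congrArg (fun μ : Measure ℝ => μ.real (Set.Iic a)) h1
  simp only [measureReal_def] at h2 ⊢
  rw [Measure.map_apply (by fun_prop) measurableSet_Iic, Measure.conv,
    ← Measure.map_id (μ := gaussianReal 0 1),
    Measure.map_map (by fun_prop) measurable_id,
    Measure.map_prod_map _ _ measurable_id (by fun_prop),
    Measure.map_map (by fun_prop) (by fun_prop), Measure.map_apply (by fun_prop) measurableSet_Iic,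
    Measure.map_id] at h2
  rw [Phi_eq_measureReal, measureReal_def]
  convert h2 using 3
  · ext p
    simp [← sub_eq_add_neg]
  · ext w
    simp [le_div_iff₀' hpos]

lemma integrable_pow_gaussian (k : ℕ) : Integrable (fun w : ℝ => w ^ k) (gaussianReal 0 1) := by
  rcases Nat.eq_zero_or_pos k with rfl | hk
  · simp
  have h := (memLp_id_gaussianReal (μ := 0) (v := 1) k).integrable_norm_pow (by omega)
  exact h.mono' (by fun_prop) (.of_forall fun w => by simp)

lemma integral_sq_gaussian : ∫ w, w ^ 2 ∂(gaussianReal 0 1) = 1 := by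
  have := variance_fun_id_gaussianReal (μ := 0) (v := 1)
  rw [variance_of_integral_eq_zero (by fun_prop) (by simp)] at this
  simpa using this

lemma integral_pow_four_gaussian : ∫ w, w ^ 4 ∂(gaussianReal 0 1) = 3 := by
  have hint : ∀ k : ℕ, Integrable (fun w : ℝ => w ^ k * normalPDF w) := by
    intro k
    have h := integrable_rpow_mul_exp_neg_mul_sq (b := 1 / 2) (by norm_num) (s := k)
      (by have : (0:ℝ) ≤ k := k.cast_nonneg
          linarith)
    refine (h.const_mul (Real.sqrt (2 * π))⁻¹).congr (.of_forall fun w => ?_)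
    simp only [normalPDF, Real.rpow_natCast]
    ring_nf
  have hG : ∀ f : ℝ → ℝ, ∫ w, f w ∂(gaussianReal 0 1) = ∫ w, f w * normalPDF w := by
    intro f
    rw [integral_gaussianReal_eq_integral_smul one_ne_zero]
    simp only [normalPDF_eq, smul_eq_mul, mul_comm]
  have hd : ∀ a, HasDerivAt (fun a => -normalPDF a) (a * normalPDF a) a := by
    intro a
    unfold normalPDF
    have := ((((hasDerivAt_id' a).fun_pow 2).fun_neg.div_const 2).exp).const_mul (Real.sqrt (2 * π))⁻¹
    exact this.fun_neg.congr_deriv (by push_cast; ring)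
  have := integral_mul_deriv_eq_deriv_mul_of_integrable (u := fun w : ℝ => w ^ 3)
    (u' := fun w => 3 * w ^ 2) (v := fun w => - normalPDF w) (v' := fun w => w * normalPDF w)
    (fun x _ => by simpa using hasDerivAt_pow 3 x) (fun x _ => hd x)
    ((hint 4).congr (.of_forall fun w => by simp only [Pi.mul_apply]; ring))
    (((hint 2).const_mul (-3)).congr (.of_forall fun w => by simp only [Pi.mul_apply]; ring))
    ((hint 3).neg.congr (.of_forall fun w => by simp only [Pi.mul_apply, Pi.neg_apply]; ring))
  have h2 := integral_sq_gaussian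
  rw [hG] at h2 ⊢
  calc ∫ w : ℝ, w ^ 4 * normalPDF w = ∫ w : ℝ, w ^ 3 * (w * normalPDF w) := by
        congr 1; ext w; ring
    _ = - ∫ w : ℝ, (3 * w ^ 2) * (- normalPDF w) := this
    _ = ∫ w : ℝ, 3 * (w ^ 2 * normalPDF w) := by
        rw [← integral_neg]; congr 1; ext w; ring
    _ = 3 := by rw [integral_const_mul, h2]; norm_num

lemma abs_integral_Phi_sub_le {α : Type*} [MeasurableSpace α] {ν : Measure α}
    [IsProbabilityMeasure ν] {X : α → ℝ} (a : ℝ) (hX : Measurable X) (h1 : Integrable X ν)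
    (h2 : Integrable (fun w => X w ^ 2) ν) (h3 : Integrable (fun w => |X w| ^ 3) ν)
    (h0 : ∫ w, X w ∂ν = 0) :
    |∫ w, Phi (a + X w) ∂ν - Phi a - (-a * normalPDF a) / 2 * ∫ w, X w ^ 2 ∂ν|
      ≤ ∫ w, |X w| ^ 3 ∂ν := by
  have hP : Integrable (fun w => Phi (a + X w)) ν := integrable_Phi_comp (by fun_prop)
  have : ∫ w, Phi (a + X w) ∂ν - Phi a - (-a * normalPDF a) / 2 * ∫ w, X w ^ 2 ∂ν =
      ∫ w, (Phi (a + X w) - Phi a - normalPDF a * X w - (-a * normalPDF a) / 2 * X w ^ 2) ∂ν := by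
    rw [integral_sub (by fun_prop) (by fun_prop), integral_sub (by fun_prop) (by fun_prop),
      integral_sub (by fun_prop) (by fun_prop), integral_const_mul, integral_const_mul, h0]
    simp
  rw [this]
  refine (abs_integral_le_integral_abs).trans (integral_mono ?_ h3 fun w => Phi_taylor a (X w))
  apply Integrable.abs
  fun_prop

/-- The third-moment constant in the Lindeberg replacement of `w² - 1` by `√2 w`. -/
def lindebergConst : ℝ :=
  ∫ w, |w ^ 2 - 1| ^ 3 ∂(gaussianReal 0 1) + ∫ w, |Real.sqrt 2 * w| ^ 3 ∂(gaussianReal 0 1)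

lemma lindebergConst_nonneg : 0 ≤ lindebergConst := by
  unfold lindebergConst
  apply add_nonneg <;> exact integral_nonneg fun w => by positivity

lemma abs_integral_Phi_sq_sub_le (a β : ℝ) :
    |∫ w, Phi (a + β * (w ^ 2 - 1)) ∂(gaussianReal 0 1) - Phi (a / Real.sqrt (1 + 2 * β ^ 2))|
      ≤ lindebergConst * |β| ^ 3 := by
  have i2 := integrable_pow_gaussian 2
  have i4 := integrable_pow_gaussian 4
  have i1 := integrable_pow_gaussian 1
  have i6 := integrable_pow_gaussian 6
  simp only [pow_one] at i1
  have e : ∫ w, Phi (a + β * Real.sqrt 2 * w) ∂(gaussianReal 0 1) =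
      Phi (a / Real.sqrt (1 + 2 * β ^ 2)) := by
    rw [integral_Phi_gaussian, mul_pow, Real.sq_sqrt (by norm_num), mul_comm (β ^ 2)]
  have s1 : ∫ w, (β * (w ^ 2 - 1)) ^ 2 ∂(gaussianReal 0 1) = 2 * β ^ 2 := by
    have : (fun w : ℝ => (β * (w ^ 2 - 1)) ^ 2) = fun w => β ^ 2 * (w ^ 4 - 2 * w ^ 2 + 1) := by
      ext w; ring
    rw [this, integral_const_mul, integral_add (by fun_prop) (by fun_prop),
      integral_sub (by fun_prop) (by fun_prop), integral_const_mul, integral_sq_gaussian,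
      integral_pow_four_gaussian]
    simp; ring
  have s2 : ∫ w, (β * Real.sqrt 2 * w) ^ 2 ∂(gaussianReal 0 1) = 2 * β ^ 2 := by
    simp_rw [mul_pow]
    rw [integral_const_mul, integral_sq_gaussian, Real.sq_sqrt (by norm_num)]; ring
  have i3 : Integrable (fun w : ℝ => |w| ^ 3) (gaussianReal 0 1) := by
    simpa [abs_pow] using (integrable_pow_gaussian 3).abs
  have j3 : Integrable (fun w : ℝ => |w ^ 2 - 1| ^ 3) (gaussianReal 0 1) := by
    have : Integrable (fun w : ℝ => (w ^ 2 - 1) ^ 3) (gaussianReal 0 1) := by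
      have : (fun w : ℝ => (w ^ 2 - 1) ^ 3) = fun w => w ^ 6 - 3 * w ^ 4 + 3 * w ^ 2 - 1 := by
        ext w; ring
      rw [this]; fun_prop
    simpa [abs_pow] using this.abs
  have t1 := abs_integral_Phi_sub_le (ν := gaussianReal 0 1) (X := fun w => β * (w ^ 2 - 1)) a
    (by fun_prop) (by fun_prop)
    (by
      have : (fun w : ℝ => (β * (w ^ 2 - 1)) ^ 2) = fun w => β ^ 2 * (w ^ 4 - 2 * w ^ 2 + 1) := by
        ext w; ring
      rw [this]; fun_prop)
    (by simp_rw [abs_mul, mul_pow]; fun_prop)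
    (by rw [integral_const_mul, integral_sub (by fun_prop) (by fun_prop), integral_sq_gaussian]; simp)
  have t2 := abs_integral_Phi_sub_le (ν := gaussianReal 0 1) (X := fun w => β * Real.sqrt 2 * w) a
    (by fun_prop) (i1.const_mul _)
    (by simp_rw [mul_pow]; fun_prop)
    (by simp_rw [abs_mul, mul_pow]; fun_prop)
    (by rw [integral_const_mul]; simp)
  rw [s1] at t1
  rw [s2, e] at t2
  have m1 : ∫ w, |β * (w ^ 2 - 1)| ^ 3 ∂(gaussianReal 0 1) =
      |β| ^ 3 * ∫ w, |w ^ 2 - 1| ^ 3 ∂(gaussianReal 0 1) := by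
    simp_rw [abs_mul, mul_pow]; rw [integral_const_mul]
  have m2 : ∫ w, |β * Real.sqrt 2 * w| ^ 3 ∂(gaussianReal 0 1) =
      |β| ^ 3 * ∫ w, |Real.sqrt 2 * w| ^ 3 ∂(gaussianReal 0 1) := by
    rw [← integral_const_mul]
    congr 1; ext w
    rw [mul_assoc, abs_mul, mul_pow]
  rw [m1] at t1
  rw [m2] at t2
  unfold lindebergConst
  rw [abs_le] at *
  constructor <;> linarith [t1.1, t1.2, t2.1, t2.2]

/-- A quantitative central limit theorem for the chi-squared distribution, tested against a
Gaussian distribution function. -/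
theorem abs_integral_Phi_chiSq_sub_le (β : ℝ) (k : ℕ) (a : ℝ) :
    |∫ q, Phi (a + β * (q - k)) ∂(chiSq k) - Phi (a / Real.sqrt (1 + 2 * k * β ^ 2))|
      ≤ k * (lindebergConst * |β| ^ 3) := by
  induction k generalizing a with
  | zero => simp [chiSq_zero]
  | succ k ih =>
    rw [integral_chiSq_succ_Phi k (F := fun q => a + β * (q - (k + 1 : ℕ))) (by fun_prop)]
    set s := Real.sqrt (1 + 2 * k * β ^ 2) with hs
    have hv : (1 : ℝ) ≤ 1 + 2 * k * β ^ 2 := by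
      have : (0 : ℝ) ≤ 2 * k * β ^ 2 := by positivity
      linarith
    have hs1 : 1 ≤ s := by rw [hs, Real.one_le_sqrt]; exact hv
    have hss : s ^ 2 = 1 + 2 * k * β ^ 2 := Real.sq_sqrt (by linarith)
    have hm : Measurable fun w : ℝ => ∫ q, Phi (a + β * (w ^ 2 + q - (k + 1 : ℕ))) ∂(chiSq k) := by
      apply StronglyMeasurable.measurable
      apply StronglyMeasurable.integral_prod_right
        (f := fun w q => Phi (a + β * (w ^ 2 + q - (k + 1 : ℕ))))
      apply Measurable.stronglyMeasurable
      apply measurable_Phi.comp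
      fun_prop
    have hint : Integrable (fun w : ℝ => ∫ q, Phi (a + β * (w ^ 2 + q - (k + 1 : ℕ))) ∂(chiSq k))
        (gaussianReal 0 1) := by
      refine Integrable.of_bound hm.aestronglyMeasurable 1 (.of_forall fun w => ?_)
      refine (norm_integral_le_of_norm_le_const (C := 1) (.of_forall fun q => ?_)).trans (by simp)
      rw [Real.norm_eq_abs, abs_of_nonneg (Phi_nonneg _)]
      exact Phi_le_one _
    have hint2 : Integrable (fun w : ℝ => Phi (a / s + β / s * (w ^ 2 - 1))) (gaussianReal 0 1) :=
      integrable_Phi_comp (by fun_prop)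
    have h1 : |∫ w, ∫ q, Phi (a + β * (w ^ 2 + q - (k + 1 : ℕ))) ∂(chiSq k) ∂(gaussianReal 0 1) -
        ∫ w, Phi (a / s + β / s * (w ^ 2 - 1)) ∂(gaussianReal 0 1)|
        ≤ k * (lindebergConst * |β| ^ 3) := by
      rw [← integral_sub hint hint2]
      rw [← Real.norm_eq_abs]
      have hb : (k : ℝ) * (lindebergConst * |β| ^ 3) =
          k * (lindebergConst * |β| ^ 3) * (gaussianReal 0 1).real Set.univ := by simp
      rw [hb]
      refine norm_integral_le_of_norm_le_const (.of_forall fun w => ?_)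
      rw [Real.norm_eq_abs]
      convert ih (a + β * (w ^ 2 - 1)) using 4
      · ext q; congr 1; push_cast; ring
      · ring
    have h2 := abs_integral_Phi_sq_sub_le (a / s) (β / s)
    have h3 : a / s / Real.sqrt (1 + 2 * (β / s) ^ 2) =
        a / Real.sqrt (1 + 2 * (k + 1 : ℕ) * β ^ 2) := by
      rw [div_div]
      congr 1
      rw [← Real.sqrt_sq (show 0 ≤ s by linarith), ← Real.sqrt_mul (by positivity)]
      congr 1
      rw [Real.sqrt_sq (show 0 ≤ s by linarith)]
      have : s ≠ 0 := by linarith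
      field_simp
      rw [hss]; push_cast; ring
    rw [h3] at h2
    have h4 : lindebergConst * |β / s| ^ 3 ≤ lindebergConst * |β| ^ 3 := by
      have := lindebergConst_nonneg
      have h5 : |β / s| ≤ |β| := by
        rw [abs_div, abs_of_pos (by linarith : 0 < s)]
        exact div_le_self (abs_nonneg _) hs1
      exact mul_le_mul_of_nonneg_left (pow_le_pow_left₀ (abs_nonneg _) h5 3) this
    rw [abs_le] at *
    push_cast at *
    constructor <;> linarith [h1.1, h1.2, h2.1, h2.2]

/-- Rotational invariance: the joint law of `⟨x, z⟩` and `‖z‖²` for a standard Gaussian `z`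
depends on `x` only through its norm. -/
lemma map_inner_normSq_pi {k : ℕ} (x : Fin (k + 1) → ℝ) :
    (Measure.pi fun _ : Fin (k + 1) => gaussianReal 0 1).map
      (fun z => (∑ i, x i * z i, ∑ i, z i ^ 2)) =
    ((gaussianReal 0 1).prod (chiSq k)).map
      (fun p => (Real.sqrt (∑ i, x i ^ 2) * p.1, p.1 ^ 2 + p.2)) := by
  set r := Real.sqrt (∑ i, x i ^ 2)
  let v : EuclideanSpace ℝ (Fin (k + 1)) := WithLp.toLp 2 x
  let w : EuclideanSpace ℝ (Fin (k + 1)) := EuclideanSpace.single 0 r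
  have hvw : ‖v‖ = ‖w‖ := by
    rw [PiLp.norm_single, Real.norm_of_nonneg (Real.sqrt_nonneg _), EuclideanSpace.norm_eq]
    simp [v]
  let f := (ℝ ∙ (v - w))ᗮ.reflection
  have hf : f v = w := Submodule.reflection_sub hvw
  let G : EuclideanSpace ℝ (Fin (k + 1)) → EuclideanSpace ℝ (Fin (k + 1)) → ℝ × ℝ :=
    fun u z => (inner ℝ u z, ‖z‖ ^ 2)
  have hG : ∀ u, Measurable (G u) := fun u => by fun_prop
  have hGf : G v ∘ f = G w := by
    ext z
    · simp only [G, Function.comp, ← hf]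
      rw [← LinearIsometryEquiv.inner_map_map f v (f z)]
      simp [f]
    · simp [G]
  have key : (stdGaussian (EuclideanSpace ℝ (Fin (k + 1)))).map (G v) =
      (stdGaussian (EuclideanSpace ℝ (Fin (k + 1)))).map (G w) := by
    conv_lhs => rw [← stdGaussian_map f]
    rw [Measure.map_map (hG v) (by fun_prop), hGf]
  rw [← map_pi_eq_stdGaussian, Measure.map_map (hG v) (by fun_prop),
    Measure.map_map (hG w) (by fun_prop)] at key
  have hv : G v ∘ WithLp.toLp 2 = fun z => (∑ i, x i * z i, ∑ i, z i ^ 2) := by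
    ext z
    · simp [G, v, PiLp.inner_apply, mul_comm]
    · simp [G, EuclideanSpace.norm_sq_eq]
  have hw : G w ∘ WithLp.toLp 2 =
      fun z => (fun p : ℝ × ℝ => (r * p.1, p.1 ^ 2 + p.2)) (z 0, ∑ i : Fin k, z i.succ ^ 2) := by
    ext z
    · simp [G, w, EuclideanSpace.inner_single_left, mul_comm]
    · simp [G, EuclideanSpace.norm_sq_eq, Fin.sum_univ_succ]
  rw [hv, hw, map_sum_eq_map_prod_chiSq (F := fun p => (r * p.1, p.1 ^ 2 + p.2)) (by fun_prop)] at key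
  exact key

lemma measure_inner_normSq_pi {k : ℕ} (x : Fin (k + 1) → ℝ) {s : Set (ℝ × ℝ)}
    (hs : MeasurableSet s) :
    (Measure.pi fun _ : Fin (k + 1) => gaussianReal 0 1)
      {z | (∑ i, x i * z i, ∑ i, z i ^ 2) ∈ s} =
    ((gaussianReal 0 1).prod (chiSq k))
      {p | (Real.sqrt (∑ i, x i ^ 2) * p.1, p.1 ^ 2 + p.2) ∈ s} := by
  have := congrArg (fun μ => μ s) (map_inner_normSq_pi x)
  rw [Measure.map_apply (by fun_prop) hs, Measure.map_apply (by fun_prop) hs] at this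
  exact this

lemma lintegral_inner_normSq_pi {k : ℕ} (x : Fin (k + 1) → ℝ) {f : ℝ × ℝ → ℝ≥0∞}
    (hf : Measurable f) :
    ∫⁻ z, f (∑ i, x i * z i, ∑ i, z i ^ 2) ∂(Measure.pi fun _ : Fin (k + 1) => gaussianReal 0 1) =
    ∫⁻ p, f (Real.sqrt (∑ i, x i ^ 2) * p.1, p.1 ^ 2 + p.2)
      ∂((gaussianReal 0 1).prod (chiSq k)) := by
  have := congrArg (fun μ => ∫⁻ y, f y ∂μ) (map_inner_normSq_pi x)
  beta_reduce at this
  rw [lintegral_map hf (by fun_prop), lintegral_map hf (by fun_prop)] at this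
  exact this

lemma lintegral_chiSq_id (k : ℕ) : ∫⁻ q, ENNReal.ofReal q ∂(chiSq k) = k := by
  induction k with
  | zero => simp [chiSq_zero]
  | succ k ih =>
    rw [lintegral_chiSq_succ k (by fun_prop)]
    have h : ∀ w : ℝ, ∫⁻ q, ENNReal.ofReal (w ^ 2 + q) ∂(chiSq k) = ENNReal.ofReal (w ^ 2) + k := by
      intro w
      rw [← ih]
      calc _ = ∫⁻ q, (ENNReal.ofReal (w ^ 2) + ENNReal.ofReal q) ∂(chiSq k) := by
            apply lintegral_congr_ae
            filter_upwards [ae_chiSq_nonneg k] with q hq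
            rw [ENNReal.ofReal_add (sq_nonneg _) hq]
        _ = _ := by
            rw [lintegral_add_left (by fun_prop)]; simp
    simp_rw [h]
    rw [lintegral_add_left (by fun_prop), ← ofReal_integral_eq_lintegral_ofReal
      (integrable_pow_gaussian 2) (.of_forall fun w => sq_nonneg w), integral_sq_gaussian]
    simp [add_comm]

lemma lintegral_chiSq_sqrt_le (k : ℕ) :
    ∫⁻ q, ENNReal.ofReal (Real.sqrt q) ∂(chiSq k) ≤ ENNReal.ofReal (Real.sqrt k) := by
  rcases Nat.eq_zero_or_pos k with rfl | hk
  · simp [chiSq_zero]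
  have hs : 0 < Real.sqrt k := Real.sqrt_pos.2 (by exact_mod_cast hk)
  calc _ ≤ ∫⁻ q, (ENNReal.ofReal (1 / (2 * Real.sqrt k)) * ENNReal.ofReal q +
          ENNReal.ofReal (Real.sqrt k / 2)) ∂(chiSq k) := by
        apply lintegral_mono_ae
        filter_upwards [ae_chiSq_nonneg k] with q hq
        rw [← ENNReal.ofReal_mul (by positivity), ← ENNReal.ofReal_add (by positivity) (by positivity)]
        apply ENNReal.ofReal_le_ofReal
        have h1 := sq_nonneg (Real.sqrt q - Real.sqrt k)
        have h2 := Real.sq_sqrt hq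
        rw [div_mul_eq_mul_div, one_mul, div_add_div _ _ (by positivity) (by norm_num),
          le_div_iff₀ (by positivity)]
        nlinarith
    _ = _ := by
        rw [lintegral_add_right _ (by fun_prop), lintegral_const_mul _ (by fun_prop),
          lintegral_chiSq_id, lintegral_const, measure_univ, mul_one,
          ← ENNReal.ofReal_natCast, ← ENNReal.ofReal_mul (by positivity),
          ← ENNReal.ofReal_add (by positivity) (by positivity)]
        congr 1
        have : (k : ℝ) = Real.sqrt k * Real.sqrt k := (Real.mul_self_sqrt (by positivity)).symm
        field_simp
        rw [Real.sq_sqrt (by positivity)]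
        ring

lemma lintegral_gaussian_tilt {f : ℝ → ℝ≥0∞} (hf : Measurable f) (s : ℝ) :
    ∫⁻ w, f w * ENNReal.ofReal (Real.exp (-s ^ 2 * w ^ 2 / 2)) ∂(gaussianReal 0 1) =
      ENNReal.ofReal (Real.sqrt (1 + s ^ 2))⁻¹ *
        ∫⁻ w, f ((Real.sqrt (1 + s ^ 2))⁻¹ * w) ∂(gaussianReal 0 1) := by
  set c := Real.sqrt (1 + s ^ 2) with hc
  have hc0 : 0 < c := by positivity
  have hcc : c ^ 2 = 1 + s ^ 2 := Real.sq_sqrt (by positivity)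
  have h1 : (gaussianReal 0 1).map (c⁻¹ * ·) = gaussianReal 0 (.mk (c⁻¹ ^ 2) (sq_nonneg _)) := by
    rw [gaussianReal_map_const_mul]; simp
  have hne : (NNReal.mk (c⁻¹ ^ 2) (sq_nonneg _) : NNReal) ≠ 0 := by
    rw [ne_eq, ← NNReal.coe_inj]; simp [hc0.ne']
  rw [← lintegral_map (f := f) (g := fun w => c⁻¹ * w) hf (by fun_prop), h1,
    gaussianReal_of_var_ne_zero _ hne, gaussianReal_of_var_ne_zero _ one_ne_zero,
    lintegral_withDensity_eq_lintegral_mul _ (measurable_gaussianPDF _ _) hf,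
    lintegral_withDensity_eq_lintegral_mul _ (measurable_gaussianPDF _ _) (by fun_prop),
    ← lintegral_const_mul _ (by
      exact (measurable_gaussianPDF _ _).mul hf)]
  congr 1; ext w
  simp only [Pi.mul_apply]
  rw [mul_left_comm, ← mul_assoc (ENNReal.ofReal c⁻¹), mul_comm]
  congr 1
  rw [mul_comm]
  simp only [gaussianPDF]
  rw [← ENNReal.ofReal_mul (by positivity), ← ENNReal.ofReal_mul (by positivity)]
  congr 1
  simp only [gaussianPDFReal, NNReal.coe_mk, NNReal.coe_one, sub_zero, mul_one]
  rw [Real.sqrt_mul (by positivity), Real.sqrt_mul (by positivity), Real.sqrt_mul (by positivity),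
    Real.sqrt_sq (by positivity)]
  rw [mul_left_comm, ← Real.exp_add]
  have e : -s ^ 2 * w ^ 2 / 2 + -w ^ 2 / 2 = -w ^ 2 / (2 * c⁻¹ ^ 2) := by
    field_simp; rw [hcc]; ring
  rw [e]
  field_simp

lemma lintegral_chiSq_tilt (k : ℕ) {f : ℝ → ℝ≥0∞} (hf : Measurable f) (s : ℝ) :
    ∫⁻ q, f q * ENNReal.ofReal (Real.exp (-s ^ 2 * q / 2)) ∂(chiSq k) =
      ENNReal.ofReal (Real.sqrt (1 + s ^ 2))⁻¹ ^ k *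
        ∫⁻ q, f (q / (1 + s ^ 2)) ∂(chiSq k) := by
  have hcc : ((Real.sqrt (1 + s ^ 2))⁻¹) ^ 2 = (1 + s ^ 2)⁻¹ := by
    rw [inv_pow, Real.sq_sqrt (by positivity)]
  induction k generalizing f with
  | zero => simp [chiSq_zero]
  | succ k ih =>
    rw [lintegral_chiSq_succ k (by fun_prop), lintegral_chiSq_succ k (by fun_prop)]
    have h1 : ∀ w : ℝ, ∫⁻ q, f (w ^ 2 + q) *
        ENNReal.ofReal (Real.exp (-s ^ 2 * (w ^ 2 + q) / 2)) ∂(chiSq k) =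
        (ENNReal.ofReal (Real.sqrt (1 + s ^ 2))⁻¹ ^ k *
          ∫⁻ q, f (w ^ 2 + q / (1 + s ^ 2)) ∂(chiSq k)) *
          ENNReal.ofReal (Real.exp (-s ^ 2 * w ^ 2 / 2)) := by
      intro w
      rw [← ih (f := fun q => f (w ^ 2 + q)) (by fun_prop), ← lintegral_mul_const _ (by fun_prop)]
      congr 1; ext q
      rw [mul_assoc, ← ENNReal.ofReal_mul (exp_pos _).le, ← Real.exp_add]
      congr 3; ring
    have hm : Measurable fun w : ℝ => ∫⁻ q, f (w ^ 2 + q / (1 + s ^ 2)) ∂(chiSq k) := by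
      apply Measurable.lintegral_prod_right (f := fun w q : ℝ => f (w ^ 2 + q / (1 + s ^ 2)))
      exact hf.comp (by fun_prop)
    simp_rw [h1]
    rw [lintegral_gaussian_tilt (hm.const_mul _), lintegral_const_mul _ (by fun_prop), ← mul_assoc,
      pow_succ' (ENNReal.ofReal (Real.sqrt (1 + s ^ 2))⁻¹) k]
    congr 1
    congr 1; ext w
    congr 1; ext q
    congr 1
    rw [mul_pow, hcc]; ring

lemma lintegral_chiSq_sqrt_tilt_le (k : ℕ) (s : ℝ) :
    ∫⁻ q, ENNReal.ofReal (Real.sqrt q) * ENNReal.ofReal (Real.exp (-s ^ 2 * q / 2)) ∂(chiSq k) ≤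
      ENNReal.ofReal (Real.sqrt k * (1 + s ^ 2) ^ (-((k + 1) / 2 : ℝ))) := by
  rw [lintegral_chiSq_tilt k (by fun_prop)]
  have hc : (Real.sqrt (1 + s ^ 2))⁻¹ = (1 + s ^ 2) ^ (-(1 / 2) : ℝ) := by
    rw [Real.sqrt_eq_rpow, Real.rpow_neg (by positivity)]
  have : ∫⁻ q, ENNReal.ofReal (Real.sqrt (q / (1 + s ^ 2))) ∂(chiSq k) =
      ENNReal.ofReal (Real.sqrt (1 + s ^ 2))⁻¹ * ∫⁻ q, ENNReal.ofReal (Real.sqrt q) ∂(chiSq k) := by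
    rw [← lintegral_const_mul _ (by fun_prop)]
    congr 1; ext q
    rw [← ENNReal.ofReal_mul (by positivity), div_eq_mul_inv, Real.sqrt_mul' _ (by positivity),
      Real.sqrt_inv, mul_comm]
  rw [this, ← mul_assoc, ← pow_succ, ← ENNReal.ofReal_pow (by positivity)]
  refine (mul_le_mul_right (lintegral_chiSq_sqrt_le k) _).trans ?_
  rw [← ENNReal.ofReal_mul (by positivity), mul_comm, hc, ← Real.rpow_natCast,
    ← Real.rpow_mul (by positivity)]
  apply ENNReal.ofReal_le_ofReal
  apply le_of_eq
  congr 2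
  push_cast; ring

lemma ae_chiSq_pos {k : ℕ} (hk : 0 < k) : ∀ᵐ q ∂(chiSq k), 0 < q := by
  obtain ⟨j, rfl⟩ := Nat.exists_eq_succ_of_ne_zero hk.ne'
  rw [Nat.succ_eq_add_one, chiSq_succ, ae_map_iff (by fun_prop) measurableSet_Ioi]
  have hne : ∀ᵐ w ∂(gaussianReal 0 1), w ≠ 0 := by
    have := nullSingletonClass_gaussianReal (μ := 0) (v := 1) one_ne_zero
    rw [ae_iff]
    simp
  filter_upwards [Measure.quasiMeasurePreserving_fst.ae hne,
    Measure.quasiMeasurePreserving_snd.ae (ae_chiSq_nonneg j)] with p hp hp2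
  have := pow_pos (abs_pos.2 hp) 2
  rw [sq_abs] at this
  change 0 < p.1 ^ 2 + p.2
  linarith

/-- Rescaling a shifted Gaussian integral over a half-line. -/
lemma lintegral_gaussian_scale {g : ℝ → ℝ≥0∞} (hg : Measurable g) {r : ℝ} (hr : 0 < r)
    (ρ κ : ℝ) :
    ∫⁻ h, (if κ * r ≤ ρ + h then g ((ρ + h) / r) else 0) ∂(gaussianReal 0 1) =
      ∫⁻ s in Set.Ici κ, g s * ENNReal.ofReal (r * normalPDF (r * s - ρ)) := by
  have hF : Measurable fun t : ℝ => if κ * r ≤ t then g (t / r) else 0 :=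
    Measurable.ite measurableSet_Ici (by fun_prop) measurable_const
  have hN : Measurable normalPDF := continuous_normalPDF.measurable
  have h1 : ∫⁻ h, (if κ * r ≤ ρ + h then g ((ρ + h) / r) else 0) ∂(gaussianReal 0 1) =
      ∫⁻ t, (if κ * r ≤ t then g (t / r) else 0) * ENNReal.ofReal (normalPDF (t - ρ)) := by
    rw [gaussianReal_of_var_ne_zero _ one_ne_zero,
      lintegral_withDensity_eq_lintegral_mul _ (measurable_gaussianPDF _ _) (by
        exact hF.comp (measurable_const_add ρ)),
      ← lintegral_add_left_eq_self (μ := volume)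
        (fun t => (if κ * r ≤ t then g (t / r) else 0) * ENNReal.ofReal (normalPDF (t - ρ))) ρ]
    congr 1; ext h
    simp only [Pi.mul_apply, gaussianPDF, ← normalPDF_eq, add_sub_cancel_left]
    rw [mul_comm]
  have h2 : ∀ F : ℝ → ℝ≥0∞, Measurable F →
      ∫⁻ t, F t = ENNReal.ofReal |r| * ∫⁻ s, F (r * s) := by
    intro F hF
    conv_lhs => rw [← Real.smul_map_volume_mul_left hr.ne', lintegral_smul_measure,
      lintegral_map hF (by fun_prop)]
    rfl
  have hFN : Measurable fun t : ℝ =>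
      (if κ * r ≤ t then g (t / r) else 0) * ENNReal.ofReal (normalPDF (t - ρ)) :=
    hF.mul (by fun_prop)
  rw [h1, h2 _ hFN, ← lintegral_indicator measurableSet_Ici,
    ← lintegral_const_mul _ (by exact hFN.comp (measurable_const_mul r))]
  congr 1; ext s
  rw [abs_of_pos hr, Set.indicator_apply]
  simp only [Set.mem_Ici, mul_comm κ r, mul_le_mul_iff_right₀ hr, mul_div_cancel_left₀ _ hr.ne']
  split_ifs
  · rw [mul_left_comm, ENNReal.ofReal_mul hr.le]
  · simp

lemma lintegral_Ici_one_add_sq_rpow_le {p κ : ℝ} (hp : 1 < p) (hκ : 0 < κ) :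
    ∫⁻ s in Set.Ici κ, ENNReal.ofReal ((1 + s ^ 2) ^ (-p)) ≤
      ENNReal.ofReal ((1 + κ ^ 2) ^ (-(p - 1)) / (2 * κ * (p - 1))) := by
  set G : ℝ → ℝ := fun s => -(1 + s ^ 2) ^ (-(p - 1)) / (2 * κ * (p - 1)) with hG
  have hp1 : 0 < p - 1 := by linarith
  have hd : ∀ s ∈ Set.Ici κ, HasDerivAt G (s / κ * (1 + s ^ 2) ^ (-p)) s := by
    intro s _
    have h0 : HasDerivAt (fun s : ℝ => 1 + s ^ 2) (2 * s) s := by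
      simpa using (hasDerivAt_pow 2 s).const_add 1
    have := ((h0.rpow_const (p := -(p - 1)) (Or.inl (by positivity))).fun_neg).div_const
      (2 * κ * (p - 1))
    refine this.congr_deriv ?_
    rw [show -(p - 1) - 1 = -p by ring]
    field_simp
  have hpos : ∀ s ∈ Set.Ioi κ, 0 ≤ s / κ * (1 + s ^ 2) ^ (-p) := by
    intro s hs
    have : 0 < s := hκ.trans hs
    positivity
  have hlim : Filter.Tendsto G Filter.atTop (nhds 0) := by
    have h1 : Filter.Tendsto (fun s : ℝ => 1 + s ^ 2) Filter.atTop Filter.atTop :=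
      Filter.tendsto_atTop_add_const_left _ _ (Filter.tendsto_pow_atTop (by norm_num))
    have := (((tendsto_rpow_neg_atTop hp1).comp h1).neg).div_const (2 * κ * (p - 1))
    rw [neg_zero, zero_div] at this
    exact this
  have hint := integrableOn_Ioi_deriv_of_nonneg' hd hpos hlim
  have hval := integral_Ioi_of_hasDerivAt_of_nonneg' hd hpos hlim
  rw [setLIntegral_congr Ioi_ae_eq_Ici.symm]
  calc _ ≤ ∫⁻ s in Set.Ioi κ, ENNReal.ofReal (s / κ * (1 + s ^ 2) ^ (-p)) := by
        refine setLIntegral_mono' measurableSet_Ioi fun s hs => ENNReal.ofReal_le_ofReal ?_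
        have h1 : 1 ≤ s / κ := by rw [one_le_div hκ]; exact (le_of_lt hs)
        exact le_mul_of_one_le_left (by positivity) h1
    _ = ENNReal.ofReal (∫ s in Set.Ioi κ, s / κ * (1 + s ^ 2) ^ (-p)) := by
        rw [ofReal_integral_eq_lintegral_ofReal hint]
        exact ae_restrict_of_forall_mem measurableSet_Ioi hpos
    _ = _ := by
        rw [hval, hG]; congr 1; ring

/-- The probability that a standard Gaussian is at least `σ` times an independent chi variable
with `k` degrees of freedom. -/
def coneProb (k : ℕ) (σ : ℝ) : ℝ≥0∞ :=
  ((gaussianReal 0 1).prod (chiSq k)) {p | σ * Real.sqrt p.2 ≤ p.1}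

lemma antitone_coneProb (k : ℕ) : Antitone (coneProb k) := by
  intro σ τ h
  refine measure_mono fun p hp => ?_
  exact (mul_le_mul_of_nonneg_right h (Real.sqrt_nonneg _)).trans hp

lemma measurable_coneProb (k : ℕ) : Measurable (coneProb k) := (antitone_coneProb k).measurable

lemma coneProb_le {k : ℕ} (hk : 2 ≤ k) {κ σ : ℝ} (hκ : 0 < κ) (hσ : κ ≤ σ) :
    coneProb k σ ≤ ENNReal.ofReal (Real.sqrt k / (κ * (k - 1))) *
      ENNReal.ofReal ((1 + σ ^ 2) ^ (-((k - 1) / 2 : ℝ))) := by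
  have hσ0 : 0 < σ := hκ.trans_le hσ
  have hk' : (2 : ℝ) ≤ k := by exact_mod_cast hk
  have hms : MeasurableSet {p : ℝ × ℝ | σ * Real.sqrt p.2 ≤ p.1} :=
    measurableSet_le (by fun_prop) (by fun_prop)
  calc coneProb k σ
      = ∫⁻ q, (gaussianReal 0 1) {h | σ * Real.sqrt q ≤ h} ∂(chiSq k) := by
        rw [coneProb, Measure.prod_apply_symm hms]; rfl
    _ ≤ ∫⁻ q, (∫⁻ s in Set.Ici σ, ENNReal.ofReal (Real.sqrt q) *
          ENNReal.ofReal (Real.exp (-s ^ 2 * q / 2))) ∂(chiSq k) := by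
        apply lintegral_mono_ae
        filter_upwards [ae_chiSq_pos (k := k) (by omega)] with q hq
        have := lintegral_gaussian_scale (g := fun _ => 1) measurable_const (Real.sqrt_pos.2 hq) 0 σ
        have h1 : (gaussianReal 0 1) {h | σ * Real.sqrt q ≤ h} =
            ∫⁻ h, (if σ * Real.sqrt q ≤ 0 + h then 1 else 0) ∂(gaussianReal 0 1) := by
          have hm : MeasurableSet {h : ℝ | σ * Real.sqrt q ≤ h} := measurableSet_Ici
          rw [← lintegral_indicator_one hm]
          congr 1; ext h
          simp [Set.indicator_apply]
        rw [h1, this]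
        refine lintegral_mono fun s => ?_
        rw [one_mul, ← ENNReal.ofReal_mul (by positivity)]
        apply ENNReal.ofReal_le_ofReal
        apply mul_le_mul_of_nonneg_left _ (by positivity)
        have h3 : -(Real.sqrt q * s - 0) ^ 2 / 2 = -s ^ 2 * q / 2 := by
          rw [sub_zero, mul_pow, Real.sq_sqrt hq.le]; ring
        rw [normalPDF, h3]
        apply mul_le_of_le_one_left (by positivity)
        apply inv_le_one_of_one_le₀
        rw [Real.one_le_sqrt]
        have := Real.pi_gt_three
        linarith
    _ = ∫⁻ s in Set.Ici σ, ∫⁻ q, ENNReal.ofReal (Real.sqrt q) *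
          ENNReal.ofReal (Real.exp (-s ^ 2 * q / 2)) ∂(chiSq k) := by
        apply lintegral_lintegral_swap
        apply Measurable.aemeasurable
        unfold Function.uncurry
        fun_prop
    _ ≤ ∫⁻ s in Set.Ici σ, ENNReal.ofReal (Real.sqrt k) *
          ENNReal.ofReal ((1 + s ^ 2) ^ (-((k + 1) / 2 : ℝ))) := by
        refine lintegral_mono fun s => ?_
        rw [← ENNReal.ofReal_mul (by positivity)]
        exact lintegral_chiSq_sqrt_tilt_le k s
    _ ≤ ENNReal.ofReal (Real.sqrt k) * ENNReal.ofReal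
          ((1 + σ ^ 2) ^ (-((k + 1) / 2 - 1 : ℝ)) / (2 * σ * ((k + 1) / 2 - 1))) := by
        rw [lintegral_const_mul _ (by fun_prop)]
        exact mul_le_mul_right (lintegral_Ici_one_add_sq_rpow_le (by linarith) hσ0) _
    _ ≤ _ := by
        rw [← ENNReal.ofReal_mul (by positivity), ← ENNReal.ofReal_mul (by
          have : (0 : ℝ) < k - 1 := by linarith
          positivity)]
        apply ENNReal.ofReal_le_ofReal
        rw [show ((k : ℝ) + 1) / 2 - 1 = (k - 1) / 2 by ring,
          show 2 * σ * (((k : ℝ) - 1) / 2) = σ * (k - 1) by ring, mul_div_assoc', div_mul_eq_mul_div]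
        have : (0 : ℝ) < k - 1 := by linarith
        gcongr

/-- Averaged probability that an independent random direction is at least as correlated with the
channel output as the transmitted codeword, on the event that the output has correlation
coefficient bounded below in terms of `κ`. -/
lemma lintegral_coneProb_le {k : ℕ} (hk : 4 ≤ k) {κ : ℝ} (hκ : 0 < κ) (ρ : ℝ) :
    ∫⁻ q, ∫⁻ h, (if κ * Real.sqrt q ≤ ρ + h then coneProb k ((ρ + h) / Real.sqrt q) else 0)
        ∂(gaussianReal 0 1) ∂(chiSq k) ≤
      ENNReal.ofReal (k * (1 + κ ^ 2) ^ (-((k - 3) / 2 : ℝ)) / (κ ^ 2 * (k - 1) * (k - 3))) := by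
  have hk' : (4 : ℝ) ≤ k := by exact_mod_cast hk
  have hk1 : (0 : ℝ) < k - 1 := by linarith
  have hk3 : (0 : ℝ) < k - 3 := by linarith
  calc _ ≤ ∫⁻ q, (ENNReal.ofReal (Real.sqrt q) * ∫⁻ s in Set.Ici κ, coneProb k s) ∂(chiSq k) := by
        apply lintegral_mono_ae
        filter_upwards [ae_chiSq_pos (k := k) (by omega)] with q hq
        rw [lintegral_gaussian_scale (measurable_coneProb k) (Real.sqrt_pos.2 hq),
          ← lintegral_const_mul _ (measurable_coneProb k)]
        refine lintegral_mono fun s => ?_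
        rw [mul_comm]
        refine mul_le_mul_left ?_ _
        apply ENNReal.ofReal_le_ofReal
        exact mul_le_of_le_one_right (by positivity) (normalPDF_le_one _)
    _ = (∫⁻ q, ENNReal.ofReal (Real.sqrt q) ∂(chiSq k)) * ∫⁻ s in Set.Ici κ, coneProb k s :=
        lintegral_mul_const _ (by fun_prop)
    _ ≤ ENNReal.ofReal (Real.sqrt k) * (ENNReal.ofReal (Real.sqrt k / (κ * (k - 1))) *
          ENNReal.ofReal ((1 + κ ^ 2) ^ (-((k - 1) / 2 - 1 : ℝ)) /
            (2 * κ * ((k - 1) / 2 - 1)))) := by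
        refine mul_le_mul' (lintegral_chiSq_sqrt_le k) ?_
        refine le_trans ?_ (mul_le_mul_right
          (lintegral_Ici_one_add_sq_rpow_le (p := ((k : ℝ) - 1) / 2) (by linarith) hκ) _)
        rw [← lintegral_const_mul _ (by fun_prop)]
        exact setLIntegral_mono' measurableSet_Ici fun s hs => coneProb_le (by omega) hκ hs
    _ = _ := by
        rw [show ((k : ℝ) - 1) / 2 - 1 = (k - 3) / 2 by ring,
          ← ENNReal.ofReal_mul (by positivity), ← ENNReal.ofReal_mul (by positivity)]
        congr 1
        have : (k : ℝ) = Real.sqrt k * Real.sqrt k := (Real.mul_self_sqrt (by positivity)).symm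
        generalize (1 + κ ^ 2) ^ (-(((k : ℝ) - 3) / 2)) = X
        rw [show 2 * κ * (((k : ℝ) - 3) / 2) = κ * (k - 3) by ring]
        have e : Real.sqrt k * (Real.sqrt k / (κ * (k - 1)) * (X / (κ * (k - 3)))) =
          (Real.sqrt k * Real.sqrt k) * X / (κ ^ 2 * (k - 1) * (k - 3)) := by
          field_simp
        rw [e, ← this]

/-- The law of a standard Gaussian vector in `ℝⁿ`. -/
abbrev stdGaussianPi (n : ℕ) : Measure (Fin n → ℝ) := Measure.pi fun _ => gaussianReal 0 1

/-- Radial projection onto the centred sphere of radius `ρ`. -/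
def sphereProj {n : ℕ} (ρ : ℝ) (g : Fin n → ℝ) : Fin n → ℝ :=
  fun i => ρ * g i / Real.sqrt (∑ j, g j ^ 2)

lemma measurable_sphereProj {n : ℕ} (ρ : ℝ) : Measurable (sphereProj (n := n) ρ) := by
  unfold sphereProj
  fun_prop

lemma sum_sq_sphereProj {n : ℕ} (ρ : ℝ) (g : Fin n → ℝ) :
    ∑ i, sphereProj ρ g i ^ 2 = ρ ^ 2 * ((∑ i, g i ^ 2) / ∑ i, g i ^ 2) := by
  have h : 0 ≤ ∑ i, g i ^ 2 := Finset.sum_nonneg fun i _ => sq_nonneg _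
  simp only [sphereProj, div_pow, mul_pow, Real.sq_sqrt h]
  rw [← Finset.sum_div, ← Finset.mul_sum, mul_div_assoc]

lemma sum_sq_sphereProj_le {n : ℕ} (ρ : ℝ) (g : Fin n → ℝ) :
    ∑ i, sphereProj ρ g i ^ 2 ≤ ρ ^ 2 := by
  rw [sum_sq_sphereProj]
  exact mul_le_of_le_one_right (sq_nonneg _) (div_self_le_one _)

lemma ae_sum_sq_sphereProj (k : ℕ) (ρ : ℝ) :
    ∀ᵐ g ∂(stdGaussianPi (k + 1)), ∑ i, sphereProj ρ g i ^ 2 = ρ ^ 2 := by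
  have h : ∀ᵐ g ∂(stdGaussianPi (k + 1)), 0 < ∑ i, g i ^ 2 := by
    have := ae_chiSq_pos (k := k + 1) (by omega)
    rw [chiSq, ae_map_iff (Measurable.aemeasurable (by fun_prop)) measurableSet_Ioi] at this
    exact this
  filter_upwards [h] with g hg
  rw [sum_sq_sphereProj, div_self hg.ne', mul_one]

lemma measure_sphereProj_inner_ge_le {k : ℕ} {ρ a q : ℝ} (hρ : 0 < ρ) (ha : 0 < a) (hq : 0 < q)
    (y : Fin (k + 1) → ℝ) (hy : ∑ i, y i ^ 2 = a ^ 2 + q) :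
    stdGaussianPi (k + 1) {g | ρ * a ≤ ∑ i, sphereProj ρ g i * y i} ≤
      coneProb k (a / Real.sqrt q) := by
  have hs : MeasurableSet {p : ℝ × ℝ | ρ * a ≤ ρ * p.1 / Real.sqrt p.2} :=
    measurableSet_le (by fun_prop) (by fun_prop)
  have h1 : {g : Fin (k + 1) → ℝ | ρ * a ≤ ∑ i, sphereProj ρ g i * y i} =
      {g | (∑ i, y i * g i, ∑ i, g i ^ 2) ∈ {p : ℝ × ℝ | ρ * a ≤ ρ * p.1 / Real.sqrt p.2}} := by
    ext g
    have : ∑ i, sphereProj ρ g i * y i = ρ * (∑ i, y i * g i) / Real.sqrt (∑ i, g i ^ 2) := by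
      rw [Finset.mul_sum, Finset.sum_div]
      refine Finset.sum_congr rfl fun i _ => ?_
      simp only [sphereProj]
      ring
    rw [Set.mem_ofPred_eq, this]
    rfl
  rw [h1, measure_inner_normSq_pi y hs, hy, coneProb]
  refine measure_mono fun p hp => ?_
  change ρ * a ≤ ρ * (Real.sqrt (a ^ 2 + q) * p.1) / Real.sqrt (p.1 ^ 2 + p.2) at hp
  change a / Real.sqrt q * Real.sqrt p.2 ≤ p.1
  have hw : 0 < Real.sqrt (p.1 ^ 2 + p.2) := by
    rcases (Real.sqrt_nonneg (p.1 ^ 2 + p.2)).eq_or_lt with h | h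
    · rw [← h, div_zero] at hp
      exact absurd hp (not_le.2 (mul_pos hρ ha))
    · exact h
  rw [mul_div_assoc, mul_le_mul_iff_right₀ hρ, le_div_iff₀ hw] at hp
  have hY : 0 < Real.sqrt (a ^ 2 + q) := Real.sqrt_pos.2 (by positivity)
  have hp1 : 0 < p.1 := by
    by_contra hcon
    have := mul_pos ha hw
    have := mul_nonpos_of_nonneg_of_nonpos hY.le (not_lt.1 hcon)
    linarith
  have hsq := pow_le_pow_left₀ (by positivity) hp 2
  rw [mul_pow, mul_pow, Real.sq_sqrt (Real.sqrt_pos.1 hw).le,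
    Real.sq_sqrt (by positivity)] at hsq
  rw [div_mul_eq_mul_div, div_le_iff₀ (Real.sqrt_pos.2 hq)]
  rcases le_or_gt p.2 0 with h | h
  · rw [Real.sqrt_eq_zero_of_nonpos h, mul_zero]
    positivity
  · refine (pow_le_pow_iff_left₀ (by positivity) (by positivity) two_ne_zero).1 ?_
    rw [mul_pow, mul_pow, Real.sq_sqrt h.le, Real.sq_sqrt hq.le]
    nlinarith

/-- In terms of the inner product `u` of the noise with a codeword of norm `ρ` and of its squared
norm `v`: the component of the output along the codeword is at least `κ` times the norm of its
orthogonal component. -/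
def InCone (ρ κ u v : ℝ) : Prop := κ * Real.sqrt (v - u ^ 2 / ρ ^ 2) ≤ ρ + u / ρ

lemma measurableSet_inCone (ρ κ : ℝ) : MeasurableSet {p : ℝ × ℝ | InCone ρ κ p.1 p.2} :=
  measurableSet_le (by fun_prop) (by fun_prop)

lemma measure_not_inCone_le {k : ℕ} {ρ : ℝ} (κ : ℝ) (hρ : 0 < ρ) (x : Fin (k + 1) → ℝ)
    (hx : ∑ i, x i ^ 2 = ρ ^ 2) :
    stdGaussianPi (k + 1) {z | ¬ InCone ρ κ (∑ i, x i * z i) (∑ i, z i ^ 2)} ≤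
      ENNReal.ofReal (∫ q, Phi (κ * Real.sqrt q - ρ) ∂(chiSq k)) := by
  have h := measure_inner_normSq_pi x (measurableSet_inCone ρ κ).compl
  rw [hx, Real.sqrt_sq hρ.le] at h
  change stdGaussianPi (k + 1) {z | (∑ i, x i * z i, ∑ i, z i ^ 2) ∈
    {p : ℝ × ℝ | InCone ρ κ p.1 p.2}ᶜ} ≤ _
  rw [h, ← measureReal_prod_le_eq_integral_Phi (by fun_prop), ofReal_measureReal]
  refine measure_mono fun p hp => ?_
  change ¬ InCone ρ κ (ρ * p.1) (p.1 ^ 2 + p.2) at hp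
  change p.1 ≤ _
  have e1 : p.1 ^ 2 + p.2 - (ρ * p.1) ^ 2 / ρ ^ 2 = p.2 := by field_simp; ring
  have e2 : ρ * p.1 / ρ = p.1 := by field_simp
  simp only [InCone, e1, e2] at hp
  linarith [not_le.1 hp]

open Classical in
lemma lintegral_collision_le {k : ℕ} (hk : 4 ≤ k) {ρ κ : ℝ} (hκ : 0 < κ) (hρ : 0 < ρ)
    (x : Fin (k + 1) → ℝ) (hx : ∑ i, x i ^ 2 = ρ ^ 2) :
    ∫⁻ z, (if InCone ρ κ (∑ i, x i * z i) (∑ i, z i ^ 2) then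
        stdGaussianPi (k + 1) {g | ∑ i, x i * (x i + z i) ≤ ∑ i, sphereProj ρ g i * (x i + z i)}
        else 0) ∂(stdGaussianPi (k + 1)) ≤
      ENNReal.ofReal (k * (1 + κ ^ 2) ^ (-((k - 3) / 2 : ℝ)) / (κ ^ 2 * (k - 1) * (k - 3))) := by
  set f : ℝ × ℝ → ℝ≥0∞ := fun p => if InCone ρ κ p.1 p.2 then
    (if 0 < p.2 - p.1 ^ 2 / ρ ^ 2 then
      coneProb k ((ρ + p.1 / ρ) / Real.sqrt (p.2 - p.1 ^ 2 / ρ ^ 2)) else 1) else 0 with hf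
  have hfm : Measurable f := by
    refine Measurable.ite (measurableSet_inCone ρ κ) (Measurable.ite ?_ ?_ measurable_const)
      measurable_const
    · exact measurableSet_lt (by fun_prop) (by fun_prop)
    · exact (measurable_coneProb k).comp (by fun_prop)
  calc _ ≤ ∫⁻ z, f (∑ i, x i * z i, ∑ i, z i ^ 2) ∂(stdGaussianPi (k + 1)) := by
        refine lintegral_mono fun z => ?_
        simp only [hf]
        split_ifs with h1 h2
        · have h3 : 0 < ρ + (∑ i, x i * z i) / ρ :=
            (mul_pos hκ (Real.sqrt_pos.2 h2)).trans_le h1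
          have e1 : ∑ i, x i * (x i + z i) = ρ * (ρ + (∑ i, x i * z i) / ρ) := by
            simp only [mul_add, Finset.sum_add_distrib]
            rw [mul_div_cancel₀ _ hρ.ne', ← pow_two, ← hx]
            simp only [pow_two]
          simp only [e1]
          refine measure_sphereProj_inner_ge_le hρ h3 h2 (fun i => x i + z i) ?_
          have e2 : ∑ i, (x i + z i) ^ 2 = ρ ^ 2 + 2 * ∑ i, x i * z i + ∑ i, z i ^ 2 := by
            rw [← hx, Finset.mul_sum, ← Finset.sum_add_distrib, ← Finset.sum_add_distrib]
            exact Finset.sum_congr rfl fun i _ => by ring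
          rw [e2]
          field_simp
          ring
        · exact prob_le_one
        · exact le_rfl
    _ = ∫⁻ p, f (ρ * p.1, p.1 ^ 2 + p.2) ∂((gaussianReal 0 1).prod (chiSq k)) := by
        rw [lintegral_inner_normSq_pi x hfm, hx, Real.sqrt_sq hρ.le]
    _ = ∫⁻ q, ∫⁻ h, f (ρ * h, h ^ 2 + q) ∂(gaussianReal 0 1) ∂(chiSq k) := by
        rw [lintegral_prod_symm]
        exact (hfm.comp (by fun_prop)).aemeasurable
    _ ≤ _ := by
        refine le_trans (lintegral_mono_ae ?_) (lintegral_coneProb_le hk hκ ρ)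
        filter_upwards [ae_chiSq_pos (k := k) (by omega)] with q hq
        refine lintegral_mono fun h => ?_
        have e1 : h ^ 2 + q - (ρ * h) ^ 2 / ρ ^ 2 = q := by field_simp; ring
        have e2 : ρ * h / ρ = h := by field_simp
        simp only [hf, InCone, e1, e2, hq, if_true]
        split_ifs <;> exact le_rfl

/-- The decoding regions of the maximal-correlation decoder. -/
def correlationRegion {n M : ℕ} (x : Fin M → Fin n → ℝ) (m : Fin M) : Set (Fin n → ℝ) :=
  {y | ∀ m', m' ≠ m → ∑ i, x m' i * y i < ∑ i, x m i * y i}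

lemma measurableSet_correlationRegion {n M : ℕ} (x : Fin M → Fin n → ℝ) (m : Fin M) :
    MeasurableSet (correlationRegion x m) := by
  simp only [correlationRegion, Set.ofPred_forall]
  exact .iInter fun m' => .iInter fun _ => measurableSet_lt (by fun_prop) (by fun_prop)

lemma disjoint_correlationRegion {n M : ℕ} (x : Fin M → Fin n → ℝ) {m m' : Fin M} (h : m ≠ m') :
    Disjoint (correlationRegion x m) (correlationRegion x m') := by
  rw [Set.disjoint_left]
  intro y hy hy'
  exact lt_asymm (hy m' h.symm) (hy' m h)

/-- The probability that the output falls outside the cone around the codeword `x`. -/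
def missProb {n : ℕ} (ρ κ : ℝ) (x : Fin n → ℝ) : ℝ≥0∞ :=
  stdGaussianPi n {z | ¬ InCone ρ κ (∑ i, x i * z i) (∑ i, z i ^ 2)}

/-- The probability that the output falls into the cone around the codeword `x`, but is at least
as correlated with `x'` as with `x`. -/
def collisionProb {n : ℕ} (ρ κ : ℝ) (x x' : Fin n → ℝ) : ℝ≥0∞ :=
  stdGaussianPi n {z | InCone ρ κ (∑ i, x i * z i) (∑ i, z i ^ 2) ∧
    ∑ i, x i * (x i + z i) ≤ ∑ i, x' i * (x i + z i)}

lemma Wn_correlationRegion_compl_le {n M : ℕ} (ρ κ : ℝ) (x : Fin M → Fin n → ℝ) (m : Fin M) :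
    Wn n (x m) (correlationRegion x m)ᶜ ≤
      missProb ρ κ (x m) + ∑ m' ∈ Finset.univ.erase m, collisionProb ρ κ (x m) (x m') := by
  set A : Set (Fin n → ℝ) := {z | ¬ InCone ρ κ (∑ i, x m i * z i) (∑ i, z i ^ 2)} with hA
  set S : Fin M → Set (Fin n → ℝ) := fun m' =>
    {z | InCone ρ κ (∑ i, x m i * z i) (∑ i, z i ^ 2) ∧
      ∑ i, x m i * (x m i + z i) ≤ ∑ i, x m' i * (x m i + z i)} with hS
  have hbound : stdGaussianPi n (A ∪ ⋃ m' ∈ Finset.univ.erase m, S m') ≤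
      stdGaussianPi n A + ∑ m' ∈ Finset.univ.erase m, stdGaussianPi n (S m') :=
    (measure_union_le _ _).trans (add_le_add le_rfl (measure_biUnion_finset_le _ _))
  refine le_trans (measure_mono ?_) hbound
  intro z hz
  by_cases h : InCone ρ κ (∑ i, x m i * z i) (∑ i, z i ^ 2)
  · have hz' : ¬ ∀ m', m' ≠ m → ∑ i, x m' i * (x m i + z i) < ∑ i, x m i * (x m i + z i) := hz
    push Not at hz'
    obtain ⟨m', hm, hle⟩ := hz'
    refine Or.inr (Set.mem_biUnion (x := m') ?_ (show z ∈ S m' from ⟨h, hle⟩))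
    exact Finset.mem_coe.2 (Finset.mem_erase.2 ⟨hm, Finset.mem_univ _⟩)
  · exact Or.inl h

lemma measurableSet_collision {n : ℕ} (ρ κ : ℝ) :
    MeasurableSet {p : ((Fin n → ℝ) × (Fin n → ℝ)) × (Fin n → ℝ) |
      InCone ρ κ (∑ i, p.1.1 i * p.2 i) (∑ i, p.2 i ^ 2) ∧
        ∑ i, p.1.1 i * (p.1.1 i + p.2 i) ≤ ∑ i, p.1.2 i * (p.1.1 i + p.2 i)} := by
  have h : Measurable fun p : ((Fin n → ℝ) × (Fin n → ℝ)) × (Fin n → ℝ) =>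
      (∑ i, p.1.1 i * p.2 i, ∑ i, p.2 i ^ 2) := by fun_prop
  have h' : MeasurableSet {p : ((Fin n → ℝ) × (Fin n → ℝ)) × (Fin n → ℝ) |
      ∑ i, p.1.1 i * (p.1.1 i + p.2 i) ≤ ∑ i, p.1.2 i * (p.1.1 i + p.2 i)} :=
    measurableSet_le (by fun_prop) (by fun_prop)
  exact (h (measurableSet_inCone ρ κ)).inter h'

lemma measurable_collisionProb {n : ℕ} (ρ κ : ℝ) :
    Measurable fun p : (Fin n → ℝ) × (Fin n → ℝ) => collisionProb ρ κ p.1 p.2 :=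
  measurable_measure_prodMk_left (measurableSet_collision ρ κ)

lemma Measurable.collisionProb {α : Type*} [MeasurableSpace α] {n : ℕ} (ρ κ : ℝ)
    {f g : α → Fin n → ℝ} (hf : Measurable f) (hg : Measurable g) :
    Measurable fun a => collisionProb ρ κ (f a) (g a) := by
  have h := (measurable_collisionProb ρ κ).comp (hf.prodMk hg)
  exact h

lemma measurable_missProb {n : ℕ} (ρ κ : ℝ) : Measurable (missProb (n := n) ρ κ) := by
  have h : Measurable fun p : (Fin n → ℝ) × (Fin n → ℝ) =>
      (∑ i, p.1 i * p.2 i, ∑ i, p.2 i ^ 2) := by fun_prop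
  exact measurable_measure_prodMk_left (h (measurableSet_inCone ρ κ).compl)

/-- The bound on the pairwise collision probability of random codewords. -/
def collisionBound (k : ℕ) (κ : ℝ) : ℝ :=
  k * (1 + κ ^ 2) ^ (-((k - 3) / 2 : ℝ)) / (κ ^ 2 * (k - 1) * (k - 3))

lemma collisionBound_nonneg {k : ℕ} (hk : 4 ≤ k) (κ : ℝ) : 0 ≤ collisionBound k κ := by
  have hk' : (4 : ℝ) ≤ k := by exact_mod_cast hk
  have hk1 : (0 : ℝ) < k - 1 := by linarith
  have hk3 : (0 : ℝ) < k - 3 := by linarith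
  unfold collisionBound
  positivity

lemma lintegral_collisionProb_le {k : ℕ} (hk : 4 ≤ k) {ρ κ : ℝ} (hκ : 0 < κ) (hρ : 0 < ρ)
    (x : Fin (k + 1) → ℝ) (hx : ∑ i, x i ^ 2 = ρ ^ 2) :
    ∫⁻ g, collisionProb ρ κ x (sphereProj ρ g) ∂(stdGaussianPi (k + 1)) ≤
      ENNReal.ofReal (collisionBound k κ) := by
  classical
  refine le_trans (le_of_eq ?_) (lintegral_collision_le hk hκ hρ x hx)
  have hS : MeasurableSet {p : (Fin (k + 1) → ℝ) × (Fin (k + 1) → ℝ) |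
      InCone ρ κ (∑ i, x i * p.2 i) (∑ i, p.2 i ^ 2) ∧
        ∑ i, x i * (x i + p.2 i) ≤ ∑ i, sphereProj ρ p.1 i * (x i + p.2 i)} := by
    have hf : Measurable fun p : (Fin (k + 1) → ℝ) × (Fin (k + 1) → ℝ) =>
        ((x, sphereProj ρ p.1), p.2) :=
      (measurable_const.prodMk ((measurable_sphereProj ρ).comp measurable_fst)).prodMk
        measurable_snd
    exact hf (measurableSet_collision ρ κ)
  have h1 := Measure.prod_apply (μ := stdGaussianPi (k + 1)) (ν := stdGaussianPi (k + 1)) hS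
  have h2 := Measure.prod_apply_symm (μ := stdGaussianPi (k + 1)) (ν := stdGaussianPi (k + 1)) hS
  refine (h1.symm.trans h2).trans ?_
  congr 1; ext z
  split_ifs with h
  · congr 1; ext g
    exact and_iff_right h
  · rw [← measure_empty (μ := stdGaussianPi (k + 1))]
    congr 1; ext g
    exact iff_of_false (fun hh => h hh.1) (by simp)

lemma map_eval_pair_pi {ι α : Type*} [Fintype ι] [MeasurableSpace α] (μ : Measure α)
    [IsProbabilityMeasure μ] {i j : ι} (hij : i ≠ j) :
    (Measure.pi fun _ : ι => μ).map (fun G => (G i, G j)) = μ.prod μ := by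
  have hind : iIndepFun (fun (i : ι) (G : ι → α) => G i) (Measure.pi fun _ : ι => μ) :=
    iIndepFun_pi (X := fun _ => id) (fun _ => aemeasurable_id)
  have h := (indepFun_iff_map_prod_eq_prod_map_map (measurable_pi_apply i).aemeasurable
    (measurable_pi_apply j).aemeasurable).1 (hind.indepFun hij)
  rw [h, (measurePreserving_eval (fun _ : ι => μ) i).map_eq,
    (measurePreserving_eval (fun _ : ι => μ) j).map_eq]

/-- Averaged error bound for random codewords distributed uniformly on a sphere. -/
lemma lintegral_random_coding_le {k : ℕ} (hk : 4 ≤ k) (M : ℕ) {ρ κ ε : ℝ} (hκ : 0 < κ)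
    (hρ : 0 < ρ)
    (hε : ∫ q, Phi (κ * Real.sqrt q - ρ) ∂(chiSq k) + M * collisionBound k κ ≤ ε) :
    ∫⁻ G, ∑ m, (missProb ρ κ (sphereProj ρ (G m)) + ∑ m' ∈ Finset.univ.erase m,
      collisionProb ρ κ (sphereProj ρ (G m)) (sphereProj ρ (G m')))
        ∂(Measure.pi fun _ : Fin M => stdGaussianPi (k + 1)) ≤ M * ENNReal.ofReal ε := by
  set p₁ := ∫ q, Phi (κ * Real.sqrt q - ρ) ∂(chiSq k) with hp₁
  have hp₁0 : 0 ≤ p₁ := integral_nonneg fun q => Phi_nonneg _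
  have hJ0 := collisionBound_nonneg hk κ
  set μ := Measure.pi fun _ : Fin M => stdGaussianPi (k + 1) with hμ
  set c : (Fin (k + 1) → ℝ) → Fin (k + 1) → ℝ := sphereProj ρ with hc
  have hcm : Measurable c := measurable_sphereProj ρ
  have hmiss : ∀ m, Measurable fun G : Fin M → Fin (k + 1) → ℝ => missProb ρ κ (c (G m)) :=
    fun m => (measurable_missProb ρ κ).comp (hcm.comp (measurable_pi_apply m))
  have hcoll : Measurable fun p : (Fin (k + 1) → ℝ) × (Fin (k + 1) → ℝ) =>
      collisionProb ρ κ (c p.1) (c p.2) :=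
    (hcm.comp measurable_fst).collisionProb ρ κ (hcm.comp measurable_snd)
  have hpair : ∀ m m' : Fin M, Measurable fun G : Fin M → Fin (k + 1) → ℝ => (G m, G m') :=
    fun m m' => (measurable_pi_apply m).prodMk (measurable_pi_apply m')
  have hcoll' : ∀ m m', Measurable fun G : Fin M → Fin (k + 1) → ℝ =>
      collisionProb ρ κ (c (G m)) (c (G m')) := fun m m' =>
    (hcm.comp (measurable_pi_apply m)).collisionProb ρ κ (hcm.comp (measurable_pi_apply m'))
  have hmissInt : ∀ m, ∫⁻ G, missProb ρ κ (c (G m)) ∂μ ≤ ENNReal.ofReal p₁ := by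
    intro m
    rw [(measurePreserving_eval (fun _ : Fin M => stdGaussianPi (k + 1)) m).lintegral_comp
      (f := fun g => missProb ρ κ (c g)) ((measurable_missProb ρ κ).comp hcm)]
    calc _ ≤ ∫⁻ _, ENNReal.ofReal p₁ ∂(stdGaussianPi (k + 1)) := by
          apply lintegral_mono_ae
          filter_upwards [ae_sum_sq_sphereProj k ρ] with g hg
          exact measure_not_inCone_le κ hρ _ hg
      _ = _ := by simp
  have hcollInt : ∀ m m', m ≠ m' → ∫⁻ G, collisionProb ρ κ (c (G m)) (c (G m')) ∂μ ≤
      ENNReal.ofReal (collisionBound k κ) := by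
    intro m m' hne
    rw [← lintegral_map (f := fun p : (Fin (k + 1) → ℝ) × (Fin (k + 1) → ℝ) =>
      collisionProb ρ κ (c p.1) (c p.2)) hcoll (hpair m m'), hμ, map_eval_pair_pi _ hne,
      lintegral_prod _ hcoll.aemeasurable]
    calc _ ≤ ∫⁻ _, ENNReal.ofReal (collisionBound k κ) ∂(stdGaussianPi (k + 1)) := by
          apply lintegral_mono_ae
          filter_upwards [ae_sum_sq_sphereProj k ρ] with g hg
          exact lintegral_collisionProb_le hk hκ hρ _ hg
      _ = _ := by simp
  calc _ = ∑ m, (∫⁻ G, missProb ρ κ (c (G m)) ∂μ +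
        ∑ m' ∈ Finset.univ.erase m, ∫⁻ G, collisionProb ρ κ (c (G m)) (c (G m')) ∂μ) := by
        rw [lintegral_finsetSum _ fun m _ => by
          exact (hmiss m).add (Finset.measurable_fun_sum _ fun m' _ => hcoll' m m')]
        refine Finset.sum_congr rfl fun m _ => ?_
        rw [lintegral_add_left (hmiss m), lintegral_finsetSum _ fun m' _ => hcoll' m m']
    _ ≤ ∑ _m : Fin M, ENNReal.ofReal ε := by
        refine Finset.sum_le_sum fun m _ => ?_
        calc _ ≤ ENNReal.ofReal p₁ + ∑ m' ∈ Finset.univ.erase m,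
              ENNReal.ofReal (collisionBound k κ) :=
              add_le_add (hmissInt m) (Finset.sum_le_sum fun m' hm' =>
                hcollInt m m' (Finset.ne_of_mem_erase hm').symm)
          _ ≤ ENNReal.ofReal p₁ + M * ENNReal.ofReal (collisionBound k κ) := by
              rw [Finset.sum_const, nsmul_eq_mul]
              gcongr
              exact (Finset.card_erase_le).trans (by simp)
          _ = ENNReal.ofReal (p₁ + M * collisionBound k κ) := by
              rw [ENNReal.ofReal_add hp₁0 (by positivity), ENNReal.ofReal_mul (by positivity),
                ENNReal.ofReal_natCast]
          _ ≤ _ := ENNReal.ofReal_le_ofReal hε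
    _ = _ := by simp

lemma measurable_random_coding (k M : ℕ) (ρ κ : ℝ) :
    Measurable fun G : Fin M → Fin (k + 1) → ℝ =>
      ∑ m, (missProb ρ κ (sphereProj ρ (G m)) + ∑ m' ∈ Finset.univ.erase m,
        collisionProb ρ κ (sphereProj ρ (G m)) (sphereProj ρ (G m'))) := by
  have hc : ∀ m, Measurable fun G : Fin M → Fin (k + 1) → ℝ => sphereProj ρ (G m) :=
    fun m => (measurable_sphereProj ρ).comp (measurable_pi_apply m)
  exact Finset.measurable_fun_sum _ fun m _ => ((measurable_missProb ρ κ).comp (hc m)).add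
    (Finset.measurable_fun_sum _ fun m' _ =>
      (hc m).collisionProb ρ κ (hc m'))

/-- Random coding bound for codewords distributed uniformly on a sphere. -/
lemma isCode_of_random_coding {k M : ℕ} (hk : 4 ≤ k) (hM : 0 < M) {ρ κ ε P : ℝ} (hκ : 0 < κ)
    (hρ : 0 < ρ) (hP : ρ ^ 2 ≤ (k + 1 : ℕ) * P)
    (hε : ∫ q, Phi (κ * Real.sqrt q - ρ) ∂(chiSq k) + M * collisionBound k κ ≤ ε) :
    IsCode (k + 1) M ε P := by
  have hε0 : 0 ≤ ε := by
    have := collisionBound_nonneg hk κ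
    have : 0 ≤ ∫ q, Phi (κ * Real.sqrt q - ρ) ∂(chiSq k) := integral_nonneg fun q => Phi_nonneg _
    exact le_trans (by positivity) hε
  obtain ⟨G, hG⟩ := exists_le_lintegral
    (μ := Measure.pi fun _ : Fin M => stdGaussianPi (k + 1))
    (measurable_random_coding k M ρ κ).aemeasurable
  have hG' := hG.trans (lintegral_random_coding_le hk M hκ hρ hε)
  set c : Fin M → Fin (k + 1) → ℝ := fun m => sphereProj ρ (G m) with hc
  refine ⟨c, correlationRegion c, fun m => (sum_sq_sphereProj_le ρ _).trans hP,
    measurableSet_correlationRegion _, fun m m' h => disjoint_correlationRegion _ h, ?_⟩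
  have hsum : ∑ m, Wn (k + 1) (c m) (correlationRegion c m)ᶜ ≤
      M * ENNReal.ofReal ε :=
    (Finset.sum_le_sum fun m _ => Wn_correlationRegion_compl_le ρ κ _ m).trans hG'
  have hfin : ∀ m ∈ Finset.univ,
      Wn (k + 1) (c m) (correlationRegion c m)ᶜ ≠ ∞ :=
    fun m _ => measure_ne_top _ _
  rw [← ENNReal.toReal_sum hfin]
  have := ENNReal.toReal_mono (by finiteness) hsum
  rw [ENNReal.toReal_mul, ENNReal.toReal_natCast, ENNReal.toReal_ofReal hε0] at this
  have hM' : (0 : ℝ) < M := by exact_mod_cast hM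
  rw [div_mul_eq_mul_div, one_mul, div_le_iff₀ hM', mul_comm ε]
  exact this

lemma pi_withDensity_eq {n : ℕ} (Q : Measure ℝ) [IsProbabilityMeasure Q] {f : Fin n → ℝ → ℝ≥0∞}
    (hf : ∀ i, Measurable (f i)) [∀ i, IsProbabilityMeasure (Q.withDensity (f i))] :
    Measure.pi (fun i => Q.withDensity (f i)) =
      (Measure.pi fun _ : Fin n => Q).withDensity fun y => ∏ i, f i (y i) := by
  refine Measure.pi_eq fun s hs => ?_
  have hms : MeasurableSet (Set.univ.pi s) := MeasurableSet.univ_pi hs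
  rw [withDensity_apply _ hms, ← lintegral_indicator hms]
  have h1 : (Set.univ.pi s).indicator (fun y => ∏ i, f i (y i)) =
      fun y => ∏ i, (s i).indicator (f i) (y i) := by
    ext y
    by_cases hy : y ∈ Set.univ.pi s
    · rw [Set.indicator_of_mem hy]
      exact Finset.prod_congr rfl fun i _ =>
        (Set.indicator_of_mem (hy i (Set.mem_univ i)) (f i)).symm
    · rw [Set.indicator_of_notMem hy]
      simp only [Set.mem_univ_pi, not_forall] at hy
      obtain ⟨i, hi⟩ := hy
      exact (Finset.prod_eq_zero (Finset.mem_univ i) (Set.indicator_of_notMem hi _)).symm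
  have hind : iIndepFun (fun (i : Fin n) (y : Fin n → ℝ) => (s i).indicator (f i) (y i))
      (Measure.pi fun _ : Fin n => Q) :=
    iIndepFun_pi (X := fun i => (s i).indicator (f i))
      (fun i => ((hf i).indicator (hs i)).aemeasurable)
  rw [h1, lintegral_prod_eq_prod_lintegral_of_indepFun Finset.univ _ hind
    (fun i => ((hf i).indicator (hs i)).comp (measurable_pi_apply i))]
  refine Finset.prod_congr rfl fun i _ => ?_
  rw [(measurePreserving_eval (fun _ : Fin n => Q) i).lintegral_comp ((hf i).indicator (hs i)),
    lintegral_indicator (hs i), withDensity_apply _ (hs i)]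

/-- Density of a unit-variance Gaussian with mean `x` with respect to a centred Gaussian with
variance `1 + P`. -/
def gaussianRatio (P x y : ℝ) : ℝ :=
  Real.sqrt (1 + P) * Real.exp (-(y - x) ^ 2 / 2 + y ^ 2 / (2 * (1 + P)))

lemma gaussianRatio_nonneg (P x y : ℝ) : 0 ≤ gaussianRatio P x y := by
  unfold gaussianRatio; positivity

lemma measurable_gaussianRatio (P x : ℝ) : Measurable (gaussianRatio P x) := by
  unfold gaussianRatio; fun_prop

/-- The centred Gaussian law with the variance of the capacity-achieving output. -/
def outputLaw (P : ℝ) : Measure ℝ := gaussianReal 0 (Real.toNNReal (1 + P))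

instance (P : ℝ) : IsProbabilityMeasure (outputLaw P) := by unfold outputLaw; infer_instance

lemma outputLaw_withDensity_gaussianRatio {P : ℝ} (hP : 0 < P) (x : ℝ) :
    (outputLaw P).withDensity (fun y => ENNReal.ofReal (gaussianRatio P x y)) =
      gaussianReal x 1 := by
  have hv : ((Real.toNNReal (1 + P) : NNReal) : ℝ) = 1 + P := Real.coe_toNNReal _ (by linarith)
  have hne : Real.toNNReal (1 + P) ≠ 0 := by
    rw [ne_eq, ← NNReal.coe_inj, hv]
    exact ne_of_gt (by simp; linarith)
  rw [outputLaw, gaussianReal_of_var_ne_zero _ hne, gaussianReal_of_var_ne_zero _ one_ne_zero,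
    ← withDensity_mul _ (measurable_gaussianPDF _ _) (measurable_gaussianRatio P x).ennreal_ofReal]
  congr 1; ext y
  simp only [Pi.mul_apply, gaussianPDF]
  rw [← ENNReal.ofReal_mul (gaussianPDFReal_nonneg _ _ _)]
  congr 1
  simp only [gaussianPDFReal, gaussianRatio, hv, NNReal.coe_one, sub_zero, mul_one]
  have h1 : (0 : ℝ) < 1 + P := by linarith
  rw [Real.sqrt_mul (by positivity) (1 + P)]
  have e : Real.exp (-(y - x) ^ 2 / 2) = Real.exp (-y ^ 2 / (2 * (1 + P))) *
      Real.exp (-(y - x) ^ 2 / 2 + y ^ 2 / (2 * (1 + P))) := by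
    rw [← Real.exp_add]; congr 1; ring
  rw [e]
  have : Real.sqrt (1 + P) ≠ 0 := (Real.sqrt_pos.2 h1).ne'
  field_simp

lemma Wn_eq_withDensity {n : ℕ} {P : ℝ} (hP : 0 < P) (x : Fin n → ℝ) {D : Set (Fin n → ℝ)}
    (hD : MeasurableSet D) :
    Wn n x D = ((Measure.pi fun _ : Fin n => outputLaw P).withDensity
      fun y => ∏ i, ENNReal.ofReal (gaussianRatio P (x i) (y i))) D := by
  have hprob : ∀ i, IsProbabilityMeasure
      ((outputLaw P).withDensity fun y => ENNReal.ofReal (gaussianRatio P (x i) y)) := by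
    intro i
    rw [outputLaw_withDensity_gaussianRatio hP]
    infer_instance
  rw [← pi_withDensity_eq (outputLaw P) (f := fun i y => ENNReal.ofReal (gaussianRatio P (x i) y))
    (fun i => (measurable_gaussianRatio P (x i)).ennreal_ofReal)]
  simp only [outputLaw_withDensity_gaussianRatio hP]
  have h : Measure.pi (fun i => gaussianReal (x i) 1) =
      (stdGaussianPi n).map fun z i => x i + z i := by
    have hi : ∀ i, (gaussianReal 0 1).map (fun z => x i + z) = gaussianReal (x i) 1 := by
      intro i
      rw [gaussianReal_map_const_add, zero_add]
    have hsf : ∀ i, SigmaFinite ((gaussianReal 0 1).map (fun z => x i + z)) := by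
      intro i
      rw [hi]
      infer_instance
    rw [stdGaussianPi, Measure.pi_map_pi fun i => Measurable.aemeasurable (by fun_prop)]
    simp only [hi]
  rw [h, Measure.map_apply (by fun_prop) hD]
  rfl

/-- The information density of the channel, up to an affine normalization, as a function of the
codeword `x` and the noise `z`. -/
def infoStat {n : ℕ} (P : ℝ) (x z : Fin n → ℝ) : ℝ :=
  ∑ i, x i ^ 2 + 2 * ∑ i, x i * z i - P * ∑ i, z i ^ 2

lemma prod_gaussianRatio {n : ℕ} {P : ℝ} (hP : 0 < P) (x z : Fin n → ℝ) :
    ∏ i, gaussianRatio P (x i) (x i + z i) =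
      Real.exp (n * gaussC P + infoStat P x z / (2 * (1 + P))) := by
  have h1 : (0 : ℝ) < 1 + P := by linarith
  have hs : Real.sqrt (1 + P) = Real.exp (gaussC P) := by
    rw [gaussC, Real.exp_half, Real.exp_log h1]
  simp only [gaussianRatio, hs, ← Real.exp_add]
  rw [← Real.exp_sum, Finset.sum_add_distrib]
  congr 1
  simp only [Finset.sum_const, Finset.card_univ, Fintype.card_fin, nsmul_eq_mul]
  congr 1
  rw [infoStat, Finset.mul_sum, Finset.mul_sum, ← Finset.sum_add_distrib, ← Finset.sum_sub_distrib,
    Finset.sum_div]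
  refine Finset.sum_congr rfl fun i _ => ?_
  field_simp
  ring

lemma Wn_le_of_infoStat {n : ℕ} {P : ℝ} (hP : 0 < P) (T : ℝ) (x : Fin n → ℝ)
    {D : Set (Fin n → ℝ)} (hD : MeasurableSet D) :
    Wn n x D ≤ ENNReal.ofReal (Real.exp (n * gaussC P + T / (2 * (1 + P)))) *
      (Measure.pi fun _ : Fin n => outputLaw P) D + stdGaussianPi n {z | T < infoStat P x z} := by
  set S : Set (Fin n → ℝ) := {y | infoStat P x (fun i => y i - x i) ≤ T} with hS
  have hSm : MeasurableSet S := by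
    refine measurableSet_le ?_ measurable_const
    unfold infoStat
    fun_prop
  have h1 : Wn n x D ≤ Wn n x (D ∩ S) + stdGaussianPi n {z | T < infoStat P x z} := by
    refine le_trans (measure_mono fun z hz => ?_) (measure_union_le _ _)
    by_cases h : (fun i => x i + z i) ∈ S
    · exact Or.inl ⟨hz, h⟩
    · right
      change ¬ infoStat P x (fun i => x i + z i - x i) ≤ T at h
      simpa using h
  refine h1.trans (add_le_add ?_ le_rfl)
  rw [Wn_eq_withDensity hP x (hD.inter hSm), withDensity_apply _ (hD.inter hSm)]
  calc _ ≤ ∫⁻ _ in D ∩ S, ENNReal.ofReal (Real.exp (n * gaussC P + T / (2 * (1 + P))))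
        ∂(Measure.pi fun _ : Fin n => outputLaw P) := by
        refine setLIntegral_mono' (hD.inter hSm) fun y hy => ?_
        rw [← ENNReal.ofReal_prod_of_nonneg fun i _ => gaussianRatio_nonneg _ _ _]
        apply ENNReal.ofReal_le_ofReal
        have h2 := prod_gaussianRatio hP x (fun i => y i - x i)
        simp only [add_sub_cancel] at h2
        rw [h2]
        have h3 : infoStat P x (fun i => y i - x i) ≤ T := hy.2
        gcongr
    _ ≤ _ := by
        rw [setLIntegral_const]
        exact mul_le_mul_right (measure_mono Set.inter_subset_left) _

lemma measureReal_infoStat_gt_le {k : ℕ} {P : ℝ} (hP : 0 < P) {r : ℝ} (hr : 0 < r) (T : ℝ)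
    (x : Fin (k + 1) → ℝ) (hx : ∑ i, x i ^ 2 ≤ r ^ 2) :
    (stdGaussianPi (k + 1)).real {z | T < infoStat P x z} ≤
      1 - ∫ q, Phi ((T + P * q - r ^ 2) / (2 * r)) ∂(chiSq k) + Phi (-(r / 2)) := by
  have hp0 : 0 ≤ ∑ i, x i ^ 2 := Finset.sum_nonneg fun i _ => sq_nonneg _
  set s := Real.sqrt (∑ i, x i ^ 2) with hs
  have hs2 : s ^ 2 = ∑ i, x i ^ 2 := Real.sq_sqrt hp0
  have hsr : s ≤ r := by
    rw [hs]; exact (Real.sqrt_le_left hr.le).2 hx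
  have hs0 : 0 ≤ s := Real.sqrt_nonneg _
  have hset : MeasurableSet {p : ℝ × ℝ | T < s ^ 2 + 2 * p.1 - P * p.2} :=
    measurableSet_lt (by fun_prop) (by fun_prop)
  set μ := (gaussianReal 0 1).prod (chiSq k) with hμ
  have h1 : (stdGaussianPi (k + 1)).real {z | T < infoStat P x z} =
      μ.real {p | T < s ^ 2 + 2 * (s * p.1) - P * (p.1 ^ 2 + p.2)} := by
    have := measure_inner_normSq_pi x hset
    rw [← hs] at this
    rw [measureReal_def, measureReal_def]
    congr 1
    refine Eq.trans ?_ this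
    congr 1; ext z
    change T < infoStat P x z ↔ T < _
    rw [infoStat, hs2]
  have hB : MeasurableSet {p : ℝ × ℝ | p.1 ≤ (T + P * p.2 - r ^ 2) / (2 * r)} :=
    measurableSet_le (by fun_prop) (by fun_prop)
  have h2 : μ.real {p | p.1 ≤ (T + P * p.2 - r ^ 2) / (2 * r)}ᶜ =
      1 - ∫ q, Phi ((T + P * q - r ^ 2) / (2 * r)) ∂(chiSq k) := by
    rw [probReal_compl_eq_one_sub hB, hμ, measureReal_prod_le_eq_integral_Phi
      (F := fun q => (T + P * q - r ^ 2) / (2 * r)) (by fun_prop)]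
  have h3 : μ.real {p | p.1 ≤ -(r / 2)} = Phi (-(r / 2)) := by
    rw [hμ, measureReal_prod_le_eq_integral_Phi (F := fun _ => -(r / 2)) (by fun_prop)]
    simp
  rw [h1, ← h2, ← h3]
  refine le_trans (measureReal_mono fun p hp => ?_) (measureReal_union_le _ _)
  change T < s ^ 2 + 2 * (s * p.1) - P * (p.1 ^ 2 + p.2) at hp
  by_contra hcon
  obtain ⟨hc1, hc2⟩ := not_or.1 hcon
  have hc1' : p.1 ≤ (T + P * p.2 - r ^ 2) / (2 * r) := not_not.1 hc1
  have hc2' : -(r / 2) < p.1 := not_le.1 hc2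
  rw [le_div_iff₀ (by positivity)] at hc1'
  have hA : T + P * p.2 < s * (s + 2 * p.1) := by
    have := mul_nonneg hP.le (sq_nonneg p.1)
    nlinarith
  have hB' : r * (r + 2 * p.1) ≤ T + P * p.2 := by nlinarith
  have hr2 : 0 < r + 2 * p.1 := by linarith
  have hpos : 0 < s * (s + 2 * p.1) := (mul_pos hr hr2).trans_le (hB'.trans hA.le)
  have hs' : 0 < s + 2 * p.1 := by
    by_contra hneg
    have := mul_nonpos_of_nonneg_of_nonpos hs0 (not_lt.1 hneg)
    linarith
  have := mul_le_mul hsr (show s + 2 * p.1 ≤ r + 2 * p.1 by linarith) hs'.le hr.le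
  linarith

/-- Finite-blocklength converse bound, via a change of measure to the capacity-achieving output
distribution. -/
lemma IsCode.size_mul_le {k M : ℕ} {ε P : ℝ} (hP : 0 < P) (h : IsCode (k + 1) M ε P) (T : ℝ)
    {r : ℝ} (hr : 0 < r) (hr2 : r ^ 2 = (k + 1 : ℕ) * P) :
    M * (∫ q, Phi ((T + P * q - r ^ 2) / (2 * r)) ∂(chiSq k) - Phi (-(r / 2)) - ε) ≤
      Real.exp ((k + 1 : ℕ) * gaussC P + T / (2 * (1 + P))) := by
  set γ₀ := Real.exp ((k + 1 : ℕ) * gaussC P + T / (2 * (1 + P))) with hγ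
  have hγ0 : 0 < γ₀ := Real.exp_pos _
  rcases Nat.eq_zero_or_pos M with rfl | hM
  · simpa using hγ0.le
  have hM' : (0 : ℝ) < M := by exact_mod_cast hM
  obtain ⟨x, D, hx, hD, hdisj, herr⟩ := h
  set Q := Measure.pi fun _ : Fin (k + 1) => outputLaw P with hQ
  set I := ∫ q, Phi ((T + P * q - r ^ 2) / (2 * r)) ∂(chiSq k) with hI
  have hone : ∀ m, 1 - (Wn (k + 1) (x m) (D m)ᶜ).toReal ≤
      γ₀ * Q.real (D m) + (1 - I + Phi (-(r / 2))) := by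
    intro m
    have hmeas : MeasurableSet {z : Fin (k + 1) → ℝ | (fun i => x m i + z i) ∈ D m} := by
      have : Measurable fun (z : Fin (k + 1) → ℝ) i => x m i + z i := by fun_prop
      exact this (hD m)
    have e1 : (Wn (k + 1) (x m) (D m)ᶜ).toReal = 1 - (Wn (k + 1) (x m) (D m)).toReal :=
      probReal_compl_eq_one_sub (μ := stdGaussianPi (k + 1)) hmeas
    have e2 := ENNReal.toReal_mono (by finiteness) (Wn_le_of_infoStat hP T (x m) (hD m))
    rw [ENNReal.toReal_add (by finiteness) (by finiteness), ENNReal.toReal_mul,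
      ENNReal.toReal_ofReal hγ0.le] at e2
    have e3 := measureReal_infoStat_gt_le hP hr T (x m) ((hx m).trans hr2.ge)
    simp only [measureReal_def] at e3 ⊢
    linarith
  have hsum := Finset.sum_le_sum fun m (_ : m ∈ Finset.univ) => hone m
  have hQsum : ∑ m, Q.real (D m) ≤ 1 := by
    rw [← measureReal_iUnion_fintype (fun m m' hne => hdisj m m' hne) hD]
    exact measureReal_le_one
  rw [Finset.sum_sub_distrib, Finset.sum_add_distrib, ← Finset.mul_sum] at hsum
  simp only [Finset.sum_const, Finset.card_univ, Fintype.card_fin, nsmul_eq_mul] at hsum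
  rw [div_mul_eq_mul_div, one_mul, div_le_iff₀ hM'] at herr
  have := mul_le_mul_of_nonneg_left hQsum hγ0.le
  nlinarith

lemma Phi_neg_le {x : ℝ} (hx : 0 < x) : Phi (-x) ≤ 1 / x ^ 2 := by
  have h := mul_meas_ge_le_integral_of_nonneg (μ := gaussianReal 0 1) (f := fun w => w ^ 2)
    (.of_forall fun w => sq_nonneg w) (integrable_pow_gaussian 2) (x ^ 2)
  rw [integral_sq_gaussian] at h
  rw [le_div_iff₀ (by positivity), mul_comm, Phi_eq_measureReal]
  refine le_trans (mul_le_mul_of_nonneg_left (measureReal_mono fun w hw => ?_) (sq_nonneg x)) h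
  have : w ≤ -x := hw
  change x ^ 2 ≤ w ^ 2
  nlinarith

lemma sqrt_gaussV_mul {P : ℝ} (hP : 0 < P) :
    (1 + P) * Real.sqrt (gaussV P) = Real.sqrt P * Real.sqrt (1 + P / 2) := by
  have h1 : (1 + P : ℝ) = Real.sqrt ((1 + P) ^ 2) := (Real.sqrt_sq (by positivity)).symm
  rw [h1, ← Real.sqrt_mul (by positivity), ← Real.sqrt_mul hP.le, gaussV]
  congr 1
  field_simp
  ring

lemma abs_sqrt_sub_sqrt_le {x y : ℝ} (hx : 1 ≤ x) (hy : 1 ≤ y) :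
    |Real.sqrt x - Real.sqrt y| ≤ |x - y| := by
  have h1 : 1 ≤ Real.sqrt x := Real.one_le_sqrt.2 hx
  have h2 : 1 ≤ Real.sqrt y := Real.one_le_sqrt.2 hy
  have e : x - y = (Real.sqrt x - Real.sqrt y) * (Real.sqrt x + Real.sqrt y) := by
    have := Real.sq_sqrt (show 0 ≤ x by linarith)
    have := Real.sq_sqrt (show 0 ≤ y by linarith)
    nlinarith
  rw [e, abs_mul]
  refine le_mul_of_one_le_right (abs_nonneg _) ?_
  rw [abs_of_nonneg (by linarith)]
  linarith

set_option maxHeartbeats 1000000 in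
/-- Lower bound on the Gaussian smoothing integral of the converse, exceeding `ε` by more than the
error terms. -/
lemma exists_converse_shift {ε P : ℝ} (hε : ε ∈ Set.Ioo (0 : ℝ) 1) (hP : 0 < P) :
    ∃ K : ℝ, ∃ N : ℕ, ∀ k : ℕ, N ≤ k + 1 → ∀ r : ℝ, r = Real.sqrt ((k + 1 : ℕ) * P) →
      1 / Real.sqrt (k + 1 : ℕ) ≤
        ∫ q, Phi ((2 * (1 + P) * (Real.sqrt ((k + 1 : ℕ) * gaussV P) * PhiInv ε + K) +
          P * q - r ^ 2) / (2 * r)) ∂(chiSq k) - Phi (-(r / 2)) - ε := by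
  obtain ⟨c, hc, hslope⟩ := exists_Phi_slope (PhiInv ε)
  set m := PhiInv ε with hm
  have hPhi : Phi m = ε := Phi_PhiInv hε
  set L := lindebergConst with hL
  have hL0 : 0 ≤ L := lindebergConst_nonneg
  set σ := Real.sqrt (1 + P / 2) with hσ
  have hσ1 : 1 ≤ σ := Real.one_le_sqrt.2 (by linarith)
  set b := Real.sqrt P with hb
  have hb0 : 0 < b := Real.sqrt_pos.2 hP
  have hb2 : b ^ 2 = P := Real.sq_sqrt hP.le
  set B := (1 + L * b ^ 3 / 8 + 4 / P) / c with hB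
  have hB0 : 0 < B := by positivity
  set K := (2 * b * σ * (B + |m| * P / 2) + P) / (2 * (1 + P)) with hK
  refine ⟨K, ⌈B ^ 2⌉₊ + 1, fun k hk r hr => ?_⟩
  set w := Real.sqrt (k + 1 : ℕ) with hw
  have hw2 : w ^ 2 = k + 1 := by
    rw [hw, Real.sq_sqrt (by positivity)]; push_cast; ring
  have hw1 : 1 ≤ w := Real.one_le_sqrt.2 (by push_cast; linarith [(Nat.cast_nonneg k : (0:ℝ) ≤ k)])
  have hw0 : 0 < w := by linarith
  have hBw : B ≤ w := by
    have h1 : B ^ 2 ≤ k + 1 := by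
      have h2 : (⌈B ^ 2⌉₊ : ℝ) + 1 ≤ k + 1 := by exact_mod_cast hk
      linarith [Nat.le_ceil (B ^ 2)]
    rw [← hw2] at h1
    exact (pow_le_pow_iff_left₀ hB0.le hw0.le two_ne_zero).1 h1
  have hr' : r = w * b := by rw [hr, Real.sqrt_mul (by positivity)]
  have hr0 : 0 < r := by rw [hr']; positivity
  have hr2 : r ^ 2 = (k + 1) * P := by rw [hr', mul_pow, hw2, hb2]
  set β := P / (2 * r) with hβ
  set a := σ * m + (B + |m| * P / 2) * σ / w with ha
  have hV : Real.sqrt ((k + 1 : ℕ) * gaussV P) = w * Real.sqrt (gaussV P) :=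
    Real.sqrt_mul (by positivity) _
  have harg : ∀ q, (2 * (1 + P) * (Real.sqrt ((k + 1 : ℕ) * gaussV P) * m + K) +
      P * q - r ^ 2) / (2 * r) = a + β * (q - k) := by
    intro q
    have e1 : 2 * (1 + P) * (Real.sqrt ((k + 1 : ℕ) * gaussV P) * m + K) =
        2 * w * m * (b * σ) + (2 * b * σ * (B + |m| * P / 2) + P) := by
      rw [hV, ← sqrt_gaussV_mul hP, hK]
      field_simp
    rw [e1, hr2, ha, hβ, hr']
    field_simp
    ring
  have hclt := abs_integral_Phi_chiSq_sub_le β k a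
  have hint : ∫ q, Phi ((2 * (1 + P) * (Real.sqrt ((k + 1 : ℕ) * gaussV P) * m + K) +
      P * q - r ^ 2) / (2 * r)) ∂(chiSq k) = ∫ q, Phi (a + β * (q - k)) ∂(chiSq k) := by
    simp_rw [harg]
  rw [hint]
  have hβ0 : 0 < β := by positivity
  have hβw : β = b / (2 * w) := by
    rw [hβ, hr', ← hb2]; field_simp
  have hk0 : (0 : ℝ) ≤ k := Nat.cast_nonneg k
  have hlind : k * (L * |β| ^ 3) ≤ L * b ^ 3 / 8 / w := by
    rw [abs_of_pos hβ0, hβw]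
    calc (k : ℝ) * (L * (b / (2 * w)) ^ 3) ≤ w ^ 2 * (L * (b / (2 * w)) ^ 3) := by
          gcongr; linarith
      _ = _ := by field_simp; norm_num
  have htail : Phi (-(r / 2)) ≤ 4 / P / w := by
    refine (Phi_neg_le (by positivity)).trans ?_
    rw [hr', div_pow, mul_pow, hb2]
    have : 1 / (w ^ 2 * P / 2 ^ 2) = 4 / P / w ^ 2 := by field_simp; norm_num
    rw [this]
    gcongr
    nlinarith
  set s := Real.sqrt (1 + 2 * k * β ^ 2) with hs
  have hs_arg : 1 + 2 * k * β ^ 2 = 1 + P / 2 - P / 2 / w ^ 2 := by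
    rw [hβw, div_pow, hb2]
    have : (k : ℝ) = w ^ 2 - 1 := by linarith
    rw [this]; field_simp; ring
  have hs1 : 1 ≤ s := Real.one_le_sqrt.2 (by
    have : 0 ≤ 2 * (k : ℝ) * β ^ 2 := by positivity
    linarith)
  have hsσ : s ≤ σ := Real.sqrt_le_sqrt (by
    rw [hs_arg]
    have : 0 ≤ P / 2 / w ^ 2 := by positivity
    linarith)
  have hdiff : σ - s ≤ P / 2 / w := by
    have h1 := abs_sqrt_sub_sqrt_le (show (1 : ℝ) ≤ 1 + P / 2 by linarith)
      (show 1 ≤ 1 + 2 * (k : ℝ) * β ^ 2 by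
        have : 0 ≤ 2 * (k : ℝ) * β ^ 2 := by positivity
        linarith)
    refine (le_abs_self _).trans (h1.trans ?_)
    rw [hs_arg, show 1 + P / 2 - (1 + P / 2 - P / 2 / w ^ 2) = P / 2 / w ^ 2 by ring,
      abs_of_nonneg (by positivity)]
    gcongr
    nlinarith
  have has : m + B / w ≤ a / s := by
    rw [le_div_iff₀ (by linarith), ha]
    have h1 : m * s ≤ σ * m + |m| * (P / 2 / w) := by
      have : -(m * (σ - s)) ≤ |m| * (P / 2 / w) := by
        refine (neg_le_abs _).trans ?_
        rw [abs_mul, abs_of_nonneg (show 0 ≤ σ - s by linarith)]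
        gcongr
      linarith
    have h2 : B / w * s ≤ B / w * σ := by gcongr
    have h3 : |m| * (P / 2 / w) ≤ |m| * (P / 2 / w) * σ := by
      exact le_mul_of_one_le_right (by positivity) hσ1
    have e : (B + |m| * P / 2) * σ / w = B / w * σ + |m| * (P / 2 / w) * σ := by
      field_simp
    rw [e]; nlinarith
  have hBw1 : B / w ≤ 1 := (div_le_one hw0).2 hBw
  have hBw0 : 0 ≤ B / w := by positivity
  have h4 := hslope m (m + B / w) (by linarith) (by linarith) (by linarith)
  have h5 := Phi_mono has
  have h6 : c * (m + B / w - m) = 1 / w + L * b ^ 3 / 8 / w + 4 / P / w := by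
    rw [hB]; field_simp; ring
  have h7 := (abs_le.1 hclt).1
  linarith

/-- Asymptotic converse. -/
lemma exists_code_size_le {ε P : ℝ} (hε : ε ∈ Set.Ioo (0 : ℝ) 1) (hP : 0 < P) :
    ∃ K : ℝ, ∃ N : ℕ, ∀ k : ℕ, N ≤ k + 1 → ∀ M : ℕ, IsCode (k + 1) M ε P →
      (M : ℝ) ≤ Real.sqrt (k + 1 : ℕ) * Real.exp ((k + 1 : ℕ) * gaussC P +
        (Real.sqrt ((k + 1 : ℕ) * gaussV P) * PhiInv ε + K)) := by
  obtain ⟨K, N, h⟩ := exists_converse_shift hε hP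
  refine ⟨K, N, fun k hk M hM => ?_⟩
  have hr : 0 < Real.sqrt ((k + 1 : ℕ) * P) := Real.sqrt_pos.2 (by positivity)
  have h1 := h k hk _ rfl
  have h2 := hM.size_mul_le hP
    (2 * (1 + P) * (Real.sqrt ((k + 1 : ℕ) * gaussV P) * PhiInv ε + K)) hr
    (Real.sq_sqrt (by positivity))
  have h3 := (mul_le_mul_of_nonneg_left h1 (Nat.cast_nonneg M)).trans h2
  have hw : 0 < Real.sqrt (k + 1 : ℕ) := Real.sqrt_pos.2 (by positivity)
  rw [mul_one_div, div_le_iff₀ hw, mul_div_cancel_left₀ _ (by positivity)] at h3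
  rw [mul_comm]
  exact h3

lemma sub_two_mul_sq_le_log_one_add {x : ℝ} (hx : -(1 / 2) ≤ x) :
    x - 2 * x ^ 2 ≤ Real.log (1 + x) := by
  have h0 : 0 < 1 + x := by linarith
  refine le_trans ?_ (Real.one_sub_inv_le_log_of_pos h0)
  have e : 1 - (1 + x)⁻¹ = x / (1 + x) := by field_simp; ring
  rw [e, le_div_iff₀ h0]
  nlinarith [sq_nonneg x, mul_nonneg (sq_nonneg x) (show 0 ≤ 1 + 2 * x by linarith)]

/-- Berry–Esseen type bound on the missed-detection probability. -/
lemma integral_Phi_mul_sqrt_sub_le {k : ℕ} (hk : 1 ≤ k) {κ : ℝ} (hκ : 0 < κ) (ρ : ℝ) :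
    ∫ q, Phi (κ * √q - ρ) ∂(chiSq k) ≤
      Phi ((κ * √k - ρ) / √(1 + κ ^ 2 / 2)) + lindebergConst * κ ^ 3 / (8 * √k) := by
  have hk0 : (0 : ℝ) < k := by exact_mod_cast hk
  have hs0 : 0 < √(k : ℝ) := Real.sqrt_pos.2 hk0
  have hs2 : √(k : ℝ) ^ 2 = k := Real.sq_sqrt hk0.le
  set β := κ / (2 * √(k : ℝ)) with hβ
  have hβ0 : 0 < β := by positivity
  have h1 : ∫ q, Phi (κ * √q - ρ) ∂(chiSq k) ≤
      ∫ q, Phi ((κ * √k - ρ) + β * (q - k)) ∂(chiSq k) := by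
    refine integral_mono_ae (integrable_Phi_comp (by fun_prop)) (integrable_Phi_comp (by fun_prop))
      ?_
    filter_upwards [ae_chiSq_nonneg k] with q hq
    refine Phi_mono ?_
    have hq2 := Real.sq_sqrt hq
    have e : (κ * √k - ρ) + β * (q - k) - (κ * √q - ρ) = β * (√q - √k) ^ 2 := by
      have : κ = β * (2 * √(k : ℝ)) := by rw [hβ]; field_simp
      rw [this]
      nlinarith
    have : 0 ≤ β * (√q - √k) ^ 2 := by positivity
    linarith
  have h2 := (abs_le.1 (abs_integral_Phi_chiSq_sub_le β k (κ * √k - ρ))).2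
  have e1 : 1 + 2 * k * β ^ 2 = 1 + κ ^ 2 / 2 := by
    rw [hβ, div_pow, mul_pow, hs2]; field_simp
  have e2 : k * (lindebergConst * |β| ^ 3) = lindebergConst * κ ^ 3 / (8 * √k) := by
    rw [abs_of_pos hβ0, hβ]
    nth_rw 1 [← hs2]
    field_simp
    norm_num
  rw [e1, e2] at h2
  linarith

lemma abs_sq_sub_sq_le {b θ w A : ℝ} (hb : 0 ≤ b) (hθ : |θ| ≤ A) (hw : 1 ≤ w) :
    |(b + θ / w) ^ 2 - b ^ 2| ≤ (2 * b * A + A ^ 2) / w := by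
  have hw0 : 0 < w := by linarith
  have e : (b + θ / w) ^ 2 - b ^ 2 = (2 * b * θ + θ ^ 2 / w) / w := by field_simp; ring
  rw [e, abs_div, abs_of_pos hw0]
  gcongr
  refine (abs_add_le _ _).trans ?_
  have h1 : |2 * b * θ| ≤ 2 * b * A := by
    rw [abs_mul, abs_of_nonneg (by positivity)]; gcongr
  have h2 : |θ ^ 2 / w| ≤ A ^ 2 := by
    rw [abs_of_nonneg (by positivity), ← sq_abs]
    calc |θ| ^ 2 / w ≤ |θ| ^ 2 / 1 := by gcongr
      _ ≤ A ^ 2 := by rw [div_one]; gcongr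
  linarith

set_option maxHeartbeats 1000000 in
/-- A threshold slope `κ` for which the missed-detection probability is at most `ε - 1 / √n`. -/
lemma exists_integral_Phi_le {ε P : ℝ} (hε : ε ∈ Set.Ioo (0 : ℝ) 1) (hP : 0 < P) :
    ∃ B A : ℝ, ∃ N : ℕ, ∀ k : ℕ, N ≤ k + 1 → ∀ w : ℝ, w = √((k + 1 : ℕ) : ℝ) →
      ∀ θ : ℝ, θ = PhiInv ε * √(1 + P / 2) - B / w → |θ| ≤ A ∧
      ∫ q, Phi ((√P + θ / w) * √q - w * √P) ∂(chiSq k) ≤ ε - 1 / w := by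
  obtain ⟨c, hc, hslope⟩ := exists_Phi_slope (PhiInv ε)
  have hPhi : Phi (PhiInv ε) = ε := Phi_PhiInv hε
  generalize PhiInv ε = m at *
  have hL0 : 0 ≤ lindebergConst := lindebergConst_nonneg
  have hσ1 : 1 ≤ √(1 + P / 2) := Real.one_le_sqrt.2 (by linarith)
  set σ := √(1 + P / 2) with hσ
  set b := √P with hb
  have hb0 : 0 < b := Real.sqrt_pos.2 hP
  have hb2 : b ^ 2 = P := Real.sq_sqrt hP.le
  set A := |m * σ| + 1 with hA
  have hA0 : 0 < A := by positivity
  set D := 2 * b * A + A ^ 2 with hD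
  have hD0 : 0 ≤ D := by positivity
  set E := (lindebergConst * b ^ 3 + 1) / c with hE
  have hE0 : 0 < E := by positivity
  set S := √(1 + 2 * P) with hS
  have hS0 : 0 ≤ S := Real.sqrt_nonneg _
  set B := E * S + |m| * (D / 2) with hB
  have hB0 : 0 ≤ B := by positivity
  set R := B + E + 2 * A / b + 2 with hR
  have hR0 : 0 ≤ R := by positivity
  refine ⟨B, A, ⌈R ^ 2⌉₊, fun k hk w hw θ hθ => ?_⟩
  have hw0 : 0 ≤ w := hw ▸ Real.sqrt_nonneg _
  have hw2 : w ^ 2 = k + 1 := by rw [hw, Real.sq_sqrt (by positivity)]; push_cast; ring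
  have hRw : R ≤ w := by
    have h2 : (⌈R ^ 2⌉₊ : ℝ) ≤ k + 1 := by exact_mod_cast hk
    have h1 : R ^ 2 ≤ w ^ 2 := by rw [hw2]; linarith [Nat.le_ceil (R ^ 2)]
    exact (pow_le_pow_iff_left₀ hR0 hw0 two_ne_zero).1 h1
  have hAb : 0 < 2 * A / b := by positivity
  have hBw : B ≤ w := by linarith
  have hEw : E ≤ w := by linarith
  have hAw : 2 * A / b ≤ w := by linarith
  have hw2' : 2 ≤ w := by linarith
  have hwp : 0 < w := by linarith
  clear_value R
  have hθA : |θ| ≤ A := by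
    rw [hθ, hA]
    refine (abs_sub _ _).trans (add_le_add le_rfl ?_)
    rw [abs_of_nonneg (by positivity)]
    exact (div_le_one hwp).2 hBw
  refine ⟨hθA, ?_⟩
  have hθw : |θ / w| ≤ b / 2 := by
    rw [abs_div, abs_of_pos hwp, div_le_iff₀ hwp]
    rw [div_le_iff₀ hb0] at hAw
    linarith
  obtain ⟨hθw1, hθw2⟩ := abs_le.1 hθw
  have hsq := abs_sq_sub_sq_le hb0.le hθA (show 1 ≤ w by linarith)
  set κ := b + θ / w with hκ
  have hκ0 : 0 < κ := by linarith
  have hκ2 : κ ≤ 3 / 2 * b := by linarith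
  have hw4 : 2 ^ 2 ≤ w ^ 2 := pow_le_pow_left₀ zero_le_two hw2' 2
  have hk1 : 1 ≤ k := by
    have : (1 : ℝ) ≤ k := by linarith
    exact_mod_cast this
  have hk0 : (0 : ℝ) < k := by exact_mod_cast hk1
  have hsk : w / 2 ≤ √(k : ℝ) := by
    refine Real.le_sqrt_of_sq_le ?_
    rw [div_pow]
    linarith
  have hskw : √(k : ℝ) ≤ w := by
    refine Real.sqrt_le_iff.2 ⟨hw0, by linarith⟩
  refine (integral_Phi_mul_sqrt_sub_le hk1 hκ0 _).trans ?_
  have hlind : lindebergConst * κ ^ 3 / (8 * √k) ≤ lindebergConst * b ^ 3 / w := by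
    calc lindebergConst * κ ^ 3 / (8 * √k) ≤ lindebergConst * (3 / 2 * b) ^ 3 / (8 * (w / 2)) := by
          gcongr
      _ ≤ lindebergConst * b ^ 3 / w := by
          rw [div_le_div_iff₀ (by positivity) hwp]
          have : 0 ≤ lindebergConst * b ^ 3 * w := by positivity
          linear_combination (5 / 8) * this
  have hs1 : 1 ≤ √(1 + κ ^ 2 / 2) := Real.one_le_sqrt.2 (by linarith [sq_nonneg κ])
  have hκP : κ ^ 2 ≤ (3 / 2) ^ 2 * P := by
    rw [← hb2, ← mul_pow]; gcongr
  have hsS : √(1 + κ ^ 2 / 2) ≤ S := Real.sqrt_le_sqrt (by linarith)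
  have hsσ : |√(1 + κ ^ 2 / 2) - σ| ≤ D / 2 / w := by
    refine (abs_sqrt_sub_sqrt_le (by linarith [sq_nonneg κ]) (by linarith)).trans ?_
    rw [show 1 + κ ^ 2 / 2 - (1 + P / 2) = (κ ^ 2 - b ^ 2) / 2 by rw [hb2]; ring, abs_div, abs_two,
      div_right_comm]
    gcongr
  set s := √(1 + κ ^ 2 / 2) with hs
  have harg : (κ * √k - w * b) / s ≤ m - E / w := by
    rw [div_le_iff₀ (by linarith)]
    have h1 : κ * √k - w * b ≤ θ := by
      have : κ * √k ≤ κ * w := by gcongr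
      have e : κ * w = w * b + θ := by rw [hκ]; field_simp
      linarith
    have h2 : -(|m| * (D / 2 / w)) ≤ m * (s - σ) := by
      have : |m * (s - σ)| ≤ |m| * (D / 2 / w) := by rw [abs_mul]; gcongr
      exact (abs_le.1 this).1
    have h3 : E / w * s ≤ E / w * S := by gcongr
    have h4 : B / w = E / w * S + |m| * (D / 2 / w) := by rw [hB]; field_simp
    rw [hθ] at h1
    linarith
  have hEw0 : 0 ≤ E / w := by positivity
  have hEw1 : E / w ≤ 1 := (div_le_one hwp).2 hEw
  have h5 := Phi_mono harg
  have h6 := hslope (m - E / w) m (by linarith) (by linarith) (by linarith)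
  have h7 : c * (m - (m - E / w)) = lindebergConst * b ^ 3 / w + 1 / w := by
    rw [sub_sub_cancel, hE]; field_simp
  linarith

lemma collisionBound_pos {k : ℕ} (hk : 4 ≤ k) {κ : ℝ} (hκ : 0 < κ) : 0 < collisionBound k κ := by
  have hk' : (4 : ℝ) ≤ k := by exact_mod_cast hk
  have h1 : (0 : ℝ) < k - 1 := by linarith
  have h3 : (0 : ℝ) < k - 3 := by linarith
  unfold collisionBound
  positivity

lemma mul_rpow_mul_collisionBound_le {k : ℕ} (hk : 8 ≤ k) {κ P : ℝ} (hP : 0 < P) (hκ : 0 < κ)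
    (h1 : P / 4 ≤ κ ^ 2) (h2 : κ ^ 2 ≤ 4 * P) :
    P / (16 * (1 + 4 * P) ^ 2) * (k + 1) * (1 + κ ^ 2) ^ ((k + 1) / 2 : ℝ) *
      collisionBound k κ ≤ 1 := by
  have hk' : (8 : ℝ) ≤ k := by exact_mod_cast hk
  have hk1 : (0 : ℝ) < k - 1 := by linarith
  have hk3 : (0 : ℝ) < k - 3 := by linarith
  have hk0 : (0 : ℝ) < k := by linarith
  have hpow : (1 + κ ^ 2) ^ ((k + 1) / 2 : ℝ) * (1 + κ ^ 2) ^ (-((k - 3) / 2) : ℝ) =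
      (1 + κ ^ 2) ^ 2 := by
    rw [← Real.rpow_add (by positivity), show ((k + 1) / 2 + -((k - 3) / 2) : ℝ) = (2 : ℕ) by
      push_cast; ring, Real.rpow_natCast]
  have e : P / (16 * (1 + 4 * P) ^ 2) * (k + 1) * (1 + κ ^ 2) ^ ((k + 1) / 2 : ℝ) *
      collisionBound k κ = P * (k + 1) * k * (1 + κ ^ 2) ^ 2 /
        (16 * (1 + 4 * P) ^ 2 * κ ^ 2 * ((k - 1) * (k - 3))) := by
    rw [← hpow, collisionBound]
    field_simp
  rw [e, div_le_one (by positivity)]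
  have h3 : (k + 1 : ℝ) * k ≤ 4 * ((k - 1) * (k - 3)) := by nlinarith
  have h4 : (1 + κ ^ 2) ^ 2 ≤ (1 + 4 * P) ^ 2 := by gcongr
  calc P * (k + 1) * k * (1 + κ ^ 2) ^ 2 = P * ((k + 1) * k) * (1 + κ ^ 2) ^ 2 := by ring
    _ ≤ (4 * κ ^ 2) * (4 * ((k - 1) * (k - 3))) * (1 + 4 * P) ^ 2 := by
        have : P ≤ 4 * κ ^ 2 := by linarith
        gcongr
    _ = _ := by ring

lemma log_sub_log_two_le_log_floor {X : ℝ} (hX : 1 ≤ X) :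
    Real.log X - Real.log 2 ≤ Real.log ⌊X⌋₊ := by
  have h1 : (1 : ℝ) ≤ ⌊X⌋₊ := by exact_mod_cast Nat.one_le_floor_iff X |>.2 hX
  rw [← Real.log_div (by linarith) two_ne_zero]
  refine Real.log_le_log (by linarith) ?_
  linarith [Nat.lt_floor_add_one X]

lemma le_mul_log_one_add_sq {P b θ κ w D : ℝ} (hP : 0 < P) (hb : b ^ 2 = P) (hw : 0 < w)
    (hκ : κ = b + θ / w) (hD : |κ ^ 2 - P| ≤ D / w) (hDw : 2 * D ≤ w) :
    w ^ 2 * (Real.log (1 + P) / 2) + w * b * θ / (1 + P) - D ^ 2 ≤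
      w ^ 2 / 2 * Real.log (1 + κ ^ 2) := by
  have hx : |(κ ^ 2 - P) / (1 + P)| ≤ D / w := by
    rw [abs_div, abs_of_pos (by positivity : 0 < 1 + P)]
    exact (div_le_self (abs_nonneg _) (by linarith)).trans hD
  have hx2 : D / w ≤ 1 / 2 := by rw [div_le_iff₀ hw]; linarith
  have hlog := sub_two_mul_sq_le_log_one_add (x := (κ ^ 2 - P) / (1 + P))
    (by linarith [(abs_le.1 hx).1])
  have e1 : Real.log (1 + κ ^ 2) = Real.log (1 + P) + Real.log (1 + (κ ^ 2 - P) / (1 + P)) := by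
    have : 1 + κ ^ 2 = (1 + P) * (1 + (κ ^ 2 - P) / (1 + P)) := by field_simp; ring
    rw [← Real.log_mul (by positivity) ?_, ← this]
    intro h0
    rw [h0, mul_zero] at this
    nlinarith [sq_nonneg κ]
  have e2 : w * b * θ / (1 + P) ≤ w ^ 2 / 2 * ((κ ^ 2 - P) / (1 + P)) := by
    have : w ^ 2 / 2 * ((κ ^ 2 - P) / (1 + P)) = w * b * θ / (1 + P) + θ ^ 2 / (2 * (1 + P)) := by
      rw [hκ, ← hb]; field_simp; ring
    rw [this]
    have : 0 ≤ θ ^ 2 / (2 * (1 + P)) := by positivity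
    linarith
  have e3 : w ^ 2 * ((κ ^ 2 - P) / (1 + P)) ^ 2 ≤ D ^ 2 := by
    calc w ^ 2 * ((κ ^ 2 - P) / (1 + P)) ^ 2 ≤ w ^ 2 * (D / w) ^ 2 := by
          rw [← sq_abs ((κ ^ 2 - P) / (1 + P))]; gcongr
      _ = D ^ 2 := by field_simp
  have h := mul_le_mul_of_nonneg_left hlog (show 0 ≤ w ^ 2 / 2 by positivity)
  rw [e1]
  linarith

set_option maxHeartbeats 1000000 in
/-- Asymptotic achievability. -/
lemma exists_code_size_ge {ε P : ℝ} (hε : ε ∈ Set.Ioo (0 : ℝ) 1) (hP : 0 < P) :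
    ∃ K : ℝ, ∃ N : ℕ, ∀ k : ℕ, N ≤ k + 1 → ∃ M : ℕ, 0 < M ∧ IsCode (k + 1) M ε P ∧
      (k + 1 : ℕ) * gaussC P + √((k + 1 : ℕ) * gaussV P) * PhiInv ε +
        1 / 2 * Real.log (k + 1 : ℕ) - K ≤ Real.log M := by
  obtain ⟨B, A, N, hmiss⟩ := exists_integral_Phi_le hε hP
  have hb0 : 0 < √P := Real.sqrt_pos.2 hP
  have hb2 : √P ^ 2 = P := Real.sq_sqrt hP.le
  have hVb := sqrt_gaussV_mul hP
  generalize PhiInv ε = m at *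
  set b := √P with hb
  set D := 2 * b * |A| + |A| ^ 2 with hD
  have hD0 : 0 ≤ D := by positivity
  set a := P / (16 * (1 + 4 * P) ^ 2) with ha
  have ha0 : 0 < a := by positivity
  set R := 1 + 2 * D + 2 * |A| / b + 1 / a with hR
  have hR0 : 0 ≤ R := by positivity
  refine ⟨Real.log 2 - Real.log a + D ^ 2 + b * B / (1 + P), max N (max 9 ⌈R ^ 2⌉₊),
    fun k hk => ?_⟩
  obtain ⟨hkN, hk⟩ := max_le_iff.1 hk
  obtain ⟨hk9, hkR⟩ := max_le_iff.1 hk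
  obtain ⟨hθA, hM⟩ := hmiss k hkN _ rfl _ rfl
  have hV : √((k + 1 : ℕ) * gaussV P) = √((k + 1 : ℕ) : ℝ) * √(gaussV P) :=
    Real.sqrt_mul (by positivity) _
  have hlogw : Real.log √((k + 1 : ℕ) : ℝ) = 1 / 2 * Real.log (k + 1 : ℕ) := by
    rw [Real.log_sqrt (by positivity)]; ring
  rw [hV, ← hlogw]
  have hw2 : √((k + 1 : ℕ) : ℝ) ^ 2 = (k + 1 : ℕ) := Real.sq_sqrt (by positivity)
  have hw0 : 0 ≤ √((k + 1 : ℕ) : ℝ) := Real.sqrt_nonneg _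
  generalize √((k + 1 : ℕ) : ℝ) = w at *
  have hRw : R ≤ w := by
    have h2 : (⌈R ^ 2⌉₊ : ℝ) ≤ (k + 1 : ℕ) := by exact_mod_cast hkR
    have h1 : R ^ 2 ≤ w ^ 2 := by rw [hw2]; linarith [Nat.le_ceil (R ^ 2)]
    exact (pow_le_pow_iff_left₀ hR0 hw0 two_ne_zero).1 h1
  have hAb : 0 ≤ 2 * |A| / b := by positivity
  have ha1 : 0 ≤ 1 / a := by positivity
  have hw1 : 1 ≤ w := by linarith
  have hDw : 2 * D ≤ w := by linarith
  have hAw : 2 * |A| / b ≤ w := by linarith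
  have haw : 1 ≤ a * w := by
    rw [← div_le_iff₀' ha0]; linarith
  have hwp : 0 < w := by linarith
  set θ := m * √(1 + P / 2) - B / w with hθ
  have hθA' : |θ| ≤ |A| := hθA.trans (le_abs_self A)
  have hθw : |θ / w| ≤ b / 2 := by
    rw [abs_div, abs_of_pos hwp, div_le_iff₀ hwp]
    rw [div_le_iff₀ hb0] at hAw
    linarith
  obtain ⟨hθw1, hθw2⟩ := abs_le.1 hθw
  have hsq := abs_sq_sub_sq_le hb0.le hθA' hw1
  rw [hb2] at hsq
  have hlog := le_mul_log_one_add_sq hP hb2 hwp rfl hsq hDw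
  set κ := b + θ / w with hκ
  have hκ0 : 0 < κ := by linarith
  have hk4 : 4 ≤ k := by omega
  have hcb := collisionBound_pos hk4 hκ0
  have hκ1 : P / 4 ≤ κ ^ 2 := by
    rw [← hb2, show b ^ 2 / 4 = (b / 2) ^ 2 by ring]
    gcongr
    linarith
  have hκ2 : κ ^ 2 ≤ 4 * P := by
    rw [← hb2, show 4 * b ^ 2 = (2 * b) ^ 2 by ring]
    gcongr
    linarith
  have hX := mul_rpow_mul_collisionBound_le (show 8 ≤ k by omega) hP hκ0 hκ1 hκ2
  rw [← ha, show (k + 1 : ℝ) = w ^ 2 by rw [hw2]; push_cast; ring] at hX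
  generalize hY : (1 + κ ^ 2) ^ (w ^ 2 / 2) = Y at hX
  have hY1 : 1 ≤ Y := by
    rw [← hY]
    exact Real.one_le_rpow (by linarith [sq_nonneg κ]) (by positivity)
  have hlogY : Real.log Y = w ^ 2 / 2 * Real.log (1 + κ ^ 2) := by
    rw [← hY, Real.log_rpow (by positivity)]
  have hXY : a * w * Y ≤ 1 / (w * collisionBound k κ) := by
    rw [le_div_iff₀ (by positivity)]
    linarith
  have hX1 : 1 ≤ a * w * Y := one_le_mul_of_one_le_of_one_le haw hY1
  set X := 1 / (w * collisionBound k κ) with hXdef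
  have hMpos : 0 < ⌊X⌋₊ := Nat.floor_pos.2 (hX1.trans hXY)
  refine ⟨⌊X⌋₊, hMpos, ?_, ?_⟩
  · refine isCode_of_random_coding hk4 hMpos (ρ := w * b) (κ := κ) hκ0 (by positivity) ?_ ?_
    · rw [mul_pow, hw2, hb2]
    · have h1 : (⌊X⌋₊ : ℝ) * collisionBound k κ ≤ 1 / w := by
        calc (⌊X⌋₊ : ℝ) * collisionBound k κ ≤ X * collisionBound k κ := by
              gcongr
              exact Nat.floor_le (by linarith)
          _ = 1 / w := by rw [hXdef]; field_simp
      linarith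
  · have h1 := log_sub_log_two_le_log_floor (hX1.trans hXY)
    have h2 := Real.log_le_log (by linarith) hXY
    rw [Real.log_mul (by positivity) (by positivity), Real.log_mul ha0.ne' hwp.ne', hlogY] at h2
    have h3 : w * b * θ / (1 + P) = w * √(gaussV P) * m - b * B / (1 + P) := by
      rw [hθ, eq_sub_iff_add_eq, eq_comm,
        show √(gaussV P) = b * √(1 + P / 2) / (1 + P) by rw [← hVb]; field_simp]
      field_simp
      ring
    rw [← hw2, gaussC]
    linarith

/-- Normal approximation with exact third-order term for the AWGN channel. -/
theorem awgn_normal_approximation (ε P : ℝ) (hε : ε ∈ Set.Ioo (0 : ℝ) 1) (hP : 0 < P) :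
    ∃ c > (0 : ℝ), ∃ N : ℕ, ∀ n : ℕ, n ≥ N →
      |Real.log (Mstar n ε P) -
        (n * gaussC P + Real.sqrt (n * gaussV P) * PhiInv ε + (1 / 2) * Real.log n)| ≤ c := by
  obtain ⟨K₁, N₁, hle⟩ := exists_code_size_le hε hP
  obtain ⟨K₂, N₂, hge⟩ := exists_code_size_ge hε hP
  refine ⟨max K₁ K₂ ⊔ 1, by positivity, max N₁ N₂ + 1, fun n hn => ?_⟩
  obtain ⟨k, rfl⟩ : ∃ k, n = k + 1 := ⟨n - 1, by omega⟩
  obtain ⟨M, hM0, hM, hMge⟩ := hge k (by omega)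
  have hbdd : BddAbove {M : ℕ | IsCode (k + 1) M ε P} :=
    ⟨⌊_⌋₊, fun M' hM' => Nat.le_floor (hle k (by omega) M' hM')⟩
  have hMM : M ≤ Mstar (k + 1) ε P := le_csSup hbdd hM
  have hcode : IsCode (k + 1) (Mstar (k + 1) ε P) ε P := Nat.sSup_mem ⟨M, hM⟩ hbdd
  have hpos : (0 : ℝ) < Mstar (k + 1) ε P := by exact_mod_cast hM0.trans_le hMM
  have hlower : Real.log M ≤ Real.log (Mstar (k + 1) ε P) :=
    Real.log_le_log (by exact_mod_cast hM0) (by exact_mod_cast hMM)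
  have hupper := Real.log_le_log hpos (hle k (by omega) _ hcode)
  rw [Real.log_mul (by positivity) (by positivity), Real.log_exp, Real.log_sqrt (by positivity)]
    at hupper
  have h1 : K₁ ≤ max K₁ K₂ ⊔ 1 := (le_max_left _ _).trans (le_max_left _ _)
  have h2 : K₂ ≤ max K₁ K₂ ⊔ 1 := (le_max_right _ _).trans (le_max_left _ _)
  rw [abs_le]
  constructor <;> linarith

end
end

section
/- Fix P > 0. Let n ≥ 3, let y ∈ ℝⁿ with s := (1/n)·‖y‖₂² ∈ [P+1−n^{−1/3}, P+1+n^{−1/3}], and let ν be the probability measure on the sphere S = {x ∈ ℝⁿ : ‖x‖₂² = nP} whose density with respect to the uniform (normalized surface) measure on S is proportional to exp(⟨x,y⟩). Then there exists N ∈ ℕ and a constant K(P) = 3·L(P,P+1)/√(P(P+1)), both depending only on P, such that for all n ≥ N, all a ∈ ℝ and all μ > 0, ν( { x ∈ S : ⟨x,y⟩ ∈ [a, a+μ] } ) ≤ K(P)·μ/√n. -/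
open MeasureTheory ProbabilityTheory Real
open scoped ENNReal

noncomputable section

/-- The constant `L(P,s)` from the paper. -/
def L (P s : ℝ) : ℝ :=
  (2 * P * s) ^ 2 / Real.sqrt (2 * π) *
    Real.sqrt ((1 + 4 * P * s - Real.sqrt (1 + 4 * P * s)) /
      (Real.sqrt (1 + 4 * P * s) - 1) ^ 5)

/-- The standard Gaussian measure `N(0, I_{n×n})` on `ℝⁿ`. -/
def stdGaussian (n : ℕ) : Measure (Fin n → ℝ) := Measure.pi fun _ : Fin n => gaussianReal 0 1

/-- The uniform (normalized surface / Haar) distribution on the sphere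
`{x ∈ ℝⁿ : ‖x‖₂² = nP}`, realized as the pushforward of the rotation-invariant standard
Gaussian measure under radial projection onto the sphere of radius `√(nP)`. -/
def sphereUniform (n : ℕ) (P : ℝ) : Measure (Fin n → ℝ) :=
  Measure.map (fun z => (Real.sqrt (n * P) / Real.sqrt (∑ i, z i ^ 2)) • z) (stdGaussian n)

/-- The posterior distribution of the input given output `y`: the probability measure on
the power sphere whose density with respect to the uniform measure on the sphere is
proportional to `exp(⟨x, y⟩)`. -/
def posterior (n : ℕ) (P : ℝ) (y : Fin n → ℝ) : Measure (Fin n → ℝ) :=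
  (∫⁻ x, ENNReal.ofReal (Real.exp (∑ i, x i * y i)) ∂(sphereUniform n P))⁻¹ •
    (sphereUniform n P).withDensity fun x => ENNReal.ofReal (Real.exp (∑ i, x i * y i))

/-- Splitting off the first coordinate of an integral against a product measure. -/
lemma lintegral_pi_succ (k : ℕ) (μ : Measure ℝ) [SigmaFinite μ] (F : (Fin (k + 1) → ℝ) → ℝ≥0∞)
    (hF : Measurable F) :
    ∫⁻ z, F z ∂(Measure.pi fun _ : Fin (k + 1) => μ) =
      ∫⁻ v, ∫⁻ x, F (Fin.cons x v) ∂μ ∂(Measure.pi fun _ : Fin k => μ) := by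
  have h := (measurePreserving_piFinSuccAbove (fun _ : Fin (k + 1) => μ) 0).symm
  rw [← h.lintegral_comp hF, lintegral_prod_symm _ (by fun_prop)]
  simp [MeasurableEquiv.piFinSuccAbove, Fin.insertNthEquiv]

/-- The density of the standard Gaussian measure with respect to Lebesgue measure. -/
lemma lintegral_stdGaussian (k : ℕ) (F : (Fin k → ℝ) → ℝ≥0∞) (hF : Measurable F) :
    ∫⁻ v, F v ∂(_root_.stdGaussian k) =
      ∫⁻ v, F v * ENNReal.ofReal ((√(2 * π))⁻¹ ^ k * exp (-(∑ i, v i ^ 2) / 2)) := by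
  unfold _root_.stdGaussian
  induction k with
  | zero => rw [volume_pi, Measure.pi_of_empty, Measure.pi_of_empty]; simp
  | succ k ih =>
    rw [lintegral_pi_succ k _ F hF, volume_pi, lintegral_pi_succ k _ _ (by fun_prop), ← volume_pi,
      ih _ (by fun_prop)]
    refine lintegral_congr fun v => ?_
    rw [gaussianReal_of_var_ne_zero 0 one_ne_zero,
      lintegral_withDensity_eq_lintegral_mul _ (measurable_gaussianPDF 0 1) (by fun_prop),
      ← lintegral_mul_const _ (by fun_prop)]
    refine lintegral_congr fun x => ?_
    simp only [Pi.mul_apply, gaussianPDF, gaussianPDFReal]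
    rw [mul_comm (ENNReal.ofReal _) (F _), mul_assoc, ← ENNReal.ofReal_mul (by positivity)]
    congr 2
    rw [Fin.sum_univ_succ]
    simp only [Fin.cons_zero, Fin.cons_succ]
    have : -(x ^ 2 + ∑ i, v i ^ 2) / 2 = -x ^ 2 / 2 + -(∑ i, v i ^ 2) / 2 := by ring
    rw [this, exp_add, pow_succ]
    simp
    ring_nf

instance isProbabilityMeasure_stdGaussian_pi (n : ℕ) : IsProbabilityMeasure (_root_.stdGaussian n) := by
  unfold _root_.stdGaussian; infer_instance

/-- How the Gaussian integral `E[|v| exp(-lam |v|²/2)]` scales, with `1 + lam = r²`. -/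
lemma lintegral_norm_exp_stdGaussian (k : ℕ) {r : ℝ} (hr : 0 < r) :
    ∫⁻ v, ENNReal.ofReal (√(∑ i, v i ^ 2) * exp (-((r ^ 2 - 1) * ∑ i, v i ^ 2) / 2))
        ∂(_root_.stdGaussian k) =
      ENNReal.ofReal (r⁻¹ ^ (k + 1)) *
        ∫⁻ v, ENNReal.ofReal (√(∑ i, v i ^ 2)) ∂(_root_.stdGaussian k) := by
  rw [lintegral_stdGaussian _ _ (by fun_prop), lintegral_stdGaussian _ _ (by fun_prop)]
  set G : (Fin k → ℝ) → ℝ≥0∞ := fun v => ENNReal.ofReal (√(∑ i, v i ^ 2)) *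
    ENNReal.ofReal ((√(2 * π))⁻¹ ^ k * exp (-(∑ i, v i ^ 2) / 2)) with hG
  have hGm : Measurable G := by fun_prop
  have h1 : ∫⁻ v : Fin k → ℝ, G (r • v) = ENNReal.ofReal (r⁻¹ ^ k) * ∫⁻ v, G v := by
    rw [← lintegral_map (f := G) hGm (measurable_const_smul r),
      Measure.map_addHaar_smul volume hr.ne', lintegral_smul_measure]
    simp [abs_of_pos hr]
  rw [pow_succ' r⁻¹ k, ENNReal.ofReal_mul (by positivity), mul_assoc, ← h1,
    ← lintegral_const_mul _ (by fun_prop)]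
  refine lintegral_congr fun v => ?_
  simp only [hG, Pi.smul_apply, smul_eq_mul, mul_pow, ← Finset.mul_sum]
  rw [← ENNReal.ofReal_mul (by positivity), ← ENNReal.ofReal_mul (by positivity),
    ← ENNReal.ofReal_mul (by positivity), sqrt_mul (sq_nonneg r), sqrt_sq hr.le]
  congr 1
  have : -(r ^ 2 * ∑ i, v i ^ 2) / 2 =
    -((r ^ 2 - 1) * ∑ i, v i ^ 2) / 2 + -(∑ i, v i ^ 2) / 2 := by ring
  rw [this, exp_add]
  field_simp

/-- The substitution `x = ρ t / √(1 - t²)` in a Gaussian integral on the line. -/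
lemma lintegral_gaussianReal_cosine {ρ : ℝ} (hρ : 0 < ρ) (h : ℝ → ℝ≥0∞) (hh : Measurable h) :
    ∫⁻ x, h (x / √(x ^ 2 + ρ ^ 2)) ∂(gaussianReal 0 1) =
      ∫⁻ t in Set.Ioo (-1 : ℝ) 1, h t * ENNReal.ofReal ((√(2 * π))⁻¹ * (√(1 - t ^ 2))⁻¹ ^ 3 *
        (ρ * exp (-(((√(1 - t ^ 2))⁻¹ ^ 2 - 1) * ρ ^ 2) / 2))) := by
  have hpos : ∀ t ∈ Set.Ioo (-1 : ℝ) 1, 0 < 1 - t ^ 2 := by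
    rintro t ⟨h1, h2⟩; nlinarith
  have hgf : ∀ t ∈ Set.Ioo (-1 : ℝ) 1,
      (ρ * t / √(1 - t ^ 2)) / √((ρ * t / √(1 - t ^ 2)) ^ 2 + ρ ^ 2) = t := by
    intro t ht
    have h0 := hpos t ht
    have h1 := sqrt_pos.2 h0
    have h2 : (ρ * t / √(1 - t ^ 2)) ^ 2 + ρ ^ 2 = (ρ / √(1 - t ^ 2)) ^ 2 := by
      rw [div_pow, div_pow, sq_sqrt h0.le]
      field_simp
      ring
    rw [h2, sqrt_sq (by positivity)]
    field_simp
  have himage : (fun t => ρ * t / √(1 - t ^ 2)) '' Set.Ioo (-1 : ℝ) 1 = Set.univ := by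
    refine Set.eq_univ_of_forall fun x => ⟨x / √(x ^ 2 + ρ ^ 2), ?_, ?_⟩
    · have h1 : |x| < √(x ^ 2 + ρ ^ 2) := by
        rw [← sqrt_sq_eq_abs]
        exact sqrt_lt_sqrt (sq_nonneg _) (by nlinarith)
      have h2 : 0 < √(x ^ 2 + ρ ^ 2) := by positivity
      rw [Set.mem_Ioo, ← abs_lt, abs_div, abs_of_pos h2, div_lt_one h2]
      exact h1
    · have h2 : 0 < √(x ^ 2 + ρ ^ 2) := by positivity
      have h3 : 1 - (x / √(x ^ 2 + ρ ^ 2)) ^ 2 = (ρ / √(x ^ 2 + ρ ^ 2)) ^ 2 := by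
        rw [div_pow, div_pow, sq_sqrt (by positivity)]
        field_simp
        ring
      simp only [h3]
      rw [sqrt_sq (by positivity)]
      field_simp
  have hderiv : ∀ t ∈ Set.Ioo (-1 : ℝ) 1, HasDerivWithinAt (fun t => ρ * t / √(1 - t ^ 2))
      (ρ * (√(1 - t ^ 2))⁻¹ ^ 3) (Set.Ioo (-1) 1) t := by
    intro t ht
    have h0 := hpos t ht
    have h1 := sqrt_pos.2 h0
    have hd : HasDerivAt (fun t : ℝ => 1 - t ^ 2) (-(2 * t)) t := by
      simpa using (hasDerivAt_pow 2 t).const_sub 1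
    have := ((hasDerivAt_id t).const_mul ρ).div (hd.sqrt h0.ne') h1.ne'
    refine (this.congr_deriv ?_).hasDerivWithinAt
    have h2 := sq_sqrt h0.le
    simp only [id]
    field_simp
    nlinarith
  have hinj : Set.InjOn (fun t => ρ * t / √(1 - t ^ 2)) (Set.Ioo (-1 : ℝ) 1) := by
    intro t ht u hu htu
    rw [← hgf t ht, ← hgf u hu]
    simp only at htu
    rw [htu]
  rw [gaussianReal_of_var_ne_zero 0 one_ne_zero,
    lintegral_withDensity_eq_lintegral_mul _ (measurable_gaussianPDF 0 1) (by fun_prop),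
    ← setLIntegral_univ, ← himage,
    lintegral_image_eq_lintegral_abs_deriv_mul measurableSet_Ioo hderiv hinj]
  refine setLIntegral_congr_fun measurableSet_Ioo fun t ht => ?_
  have h0 := hpos t ht
  have h1 := sqrt_pos.2 h0
  simp only [Pi.mul_apply, hgf t ht, gaussianPDF, gaussianPDFReal]
  rw [← mul_assoc, ← ENNReal.ofReal_mul (by positivity), mul_comm (h t)]
  congr 2
  rw [abs_of_pos (by positivity)]
  have : -(((√(1 - t ^ 2))⁻¹ ^ 2 - 1) * ρ ^ 2) / 2 = -(ρ * t / √(1 - t ^ 2) - 0) ^ 2 / 2 := by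
    rw [inv_pow, sub_zero, div_pow, sq_sqrt h0.le]
    field_simp
    ring
  rw [this]
  simp
  ring_nf

/-- The law of the first coordinate of a normalized standard Gaussian vector, up to the value
of the normalizing constant. -/
lemma lintegral_cosine_stdGaussian (j : ℕ) (h : ℝ → ℝ≥0∞) (hh : Measurable h) :
    ∫⁻ z, h (z 0 / √(∑ i, z i ^ 2)) ∂(_root_.stdGaussian (j + 3)) =
      (ENNReal.ofReal (√(2 * π))⁻¹ *
        ∫⁻ v, ENNReal.ofReal (√(∑ i, v i ^ 2)) ∂(_root_.stdGaussian (j + 2))) *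
      ∫⁻ t in Set.Ioo (-1 : ℝ) 1, h t * ENNReal.ofReal (√(1 - t ^ 2) ^ j) := by
  have hae : ∀ᵐ v ∂(_root_.stdGaussian (j + 2)), v ≠ 0 := by
    have : NullSingletonClass (gaussianReal 0 1) := nullSingletonClass_gaussianReal one_ne_zero
    have h0 : _root_.stdGaussian (j + 2) {0} = 0 := by
      unfold _root_.stdGaussian
      rw [← Set.univ_pi_singleton, Measure.pi_pi]
      simp
    rw [ae_iff]
    simpa using h0
  have h1 : ∫⁻ z, h (z 0 / √(∑ i, z i ^ 2)) ∂(_root_.stdGaussian (j + 3)) =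
      ∫⁻ v, (∫⁻ t in Set.Ioo (-1 : ℝ) 1, h t * ENNReal.ofReal
        ((√(2 * π))⁻¹ * (√(1 - t ^ 2))⁻¹ ^ 3 * (√(∑ i, v i ^ 2) *
          exp (-(((√(1 - t ^ 2))⁻¹ ^ 2 - 1) * ∑ i, v i ^ 2) / 2))))
        ∂(_root_.stdGaussian (j + 2)) := by
    unfold _root_.stdGaussian
    rw [lintegral_pi_succ (j + 2) _ _ (by fun_prop)]
    refine lintegral_congr_ae ?_
    filter_upwards [hae] with v hv
    have hS : 0 < ∑ i, v i ^ 2 := by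
      obtain ⟨i, hi⟩ := Function.ne_iff.1 hv
      exact Finset.sum_pos' (fun i _ => sq_nonneg _)
        ⟨i, Finset.mem_univ _, by have : v i ≠ 0 := hi; positivity⟩
    have := lintegral_gaussianReal_cosine (sqrt_pos.2 hS) h hh
    rw [sq_sqrt hS.le] at this
    rw [← this]
    simp [Fin.sum_univ_succ (n := j + 2)]
  rw [h1, lintegral_lintegral_swap (by fun_prop), ← lintegral_const_mul _ (by fun_prop)]
  refine setLIntegral_congr_fun measurableSet_Ioo fun t ht => ?_
  have h0 : 0 < 1 - t ^ 2 := by nlinarith [ht.1, ht.2]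
  have hs := sqrt_pos.2 h0
  have hsplit : ∀ v : Fin (j + 2) → ℝ, h t * ENNReal.ofReal
        ((√(2 * π))⁻¹ * (√(1 - t ^ 2))⁻¹ ^ 3 * (√(∑ i, v i ^ 2) *
          exp (-(((√(1 - t ^ 2))⁻¹ ^ 2 - 1) * ∑ i, v i ^ 2) / 2))) =
      h t * ENNReal.ofReal ((√(2 * π))⁻¹ * (√(1 - t ^ 2))⁻¹ ^ 3) *
        ENNReal.ofReal (√(∑ i, v i ^ 2) *
          exp (-(((√(1 - t ^ 2))⁻¹ ^ 2 - 1) * ∑ i, v i ^ 2) / 2)) := by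
    intro v
    rw [ENNReal.ofReal_mul (by positivity), mul_assoc]
  simp only [hsplit]
  rw [lintegral_const_mul _ (by fun_prop), lintegral_norm_exp_stdGaussian _ (inv_pos.2 hs)]
  have hw : ENNReal.ofReal ((√(2 * π))⁻¹ * (√(1 - t ^ 2))⁻¹ ^ 3) *
      ENNReal.ofReal ((√(1 - t ^ 2))⁻¹⁻¹ ^ (j + 2 + 1)) =
      ENNReal.ofReal (√(2 * π))⁻¹ * ENNReal.ofReal (√(1 - t ^ 2) ^ j) := by
    rw [← ENNReal.ofReal_mul (by positivity), ← ENNReal.ofReal_mul (by positivity), inv_inv]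
    congr 1
    rw [show j + 2 + 1 = j + 3 from rfl, pow_add]
    field_simp
  rw [← mul_assoc, mul_assoc (h t), hw]
  ring

/-- Rotation invariance of the standard Gaussian measure: a normalized inner product with a
fixed vector has the law of the normalized first coordinate. -/
lemma lintegral_inner_stdGaussian (m : ℕ) (y : Fin (m + 1) → ℝ) (hy : 0 < ∑ i, y i ^ 2)
    (h : ℝ → ℝ≥0∞) (hh : Measurable h) :
    ∫⁻ z, h ((∑ i, z i * y i) / (√(∑ i, y i ^ 2) * √(∑ i, z i ^ 2)))
        ∂(_root_.stdGaussian (m + 1)) =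
      ∫⁻ z, h (z 0 / √(∑ i, z i ^ 2)) ∂(_root_.stdGaussian (m + 1)) := by
  set Y : EuclideanSpace ℝ (Fin (m + 1)) := WithLp.toLp 2 y with hY
  have hYn : ‖Y‖ = √(∑ i, y i ^ 2) := by simp [EuclideanSpace.norm_eq, hY]
  have hYpos : 0 < ‖Y‖ := by rw [hYn]; exact sqrt_pos.2 hy
  have hon : Orthonormal ℝ (({0} : Set (Fin (m + 1))).domRestrict fun _ => ‖Y‖⁻¹ • Y) := by
    rw [orthonormal_iff_ite]
    rintro ⟨i, hi⟩ ⟨i', hi'⟩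
    obtain rfl : i = 0 := hi
    obtain rfl : i' = 0 := hi'
    simp [norm_smul, hYpos.ne']
  obtain ⟨b, hb⟩ := hon.exists_orthonormalBasis_extension_of_card_eq (by simp)
  have hb0 : b 0 = ‖Y‖⁻¹ • Y := hb 0 rfl
  have hmeas := stdGaussian_eq_map_pi_orthonormalBasis b
  rw [← map_pi_eq_stdGaussian] at hmeas
  set H : EuclideanSpace ℝ (Fin (m + 1)) → ℝ≥0∞ := fun x => h (inner ℝ Y x / (‖Y‖ * ‖x‖)) with hH
  have hHm : Measurable H := by fun_prop
  have h1 : ∫⁻ z, H z ∂((Measure.pi fun _ : Fin (m + 1) => gaussianReal 0 1).map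
      (WithLp.toLp 2)) = ∫⁻ z, H z ∂((Measure.pi fun _ : Fin (m + 1) => gaussianReal 0 1).map
      (fun x => ∑ i, x i • b i)) := by rw [hmeas]
  rw [lintegral_map hHm (by fun_prop), lintegral_map hHm (by fun_prop)] at h1
  unfold _root_.stdGaussian
  convert! h1 using 3 with z z
  · rw [hH, hYn]
    simp [EuclideanSpace.norm_eq, hY, PiLp.inner_apply]
  · have hn : ‖∑ i, z i • b i‖ = √(∑ i, z i ^ 2) := by
      rw [← b.repr.norm_map, EuclideanSpace.norm_eq]
      congr 1
      refine Finset.sum_congr rfl fun i _ => ?_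
      simp [Pi.single_apply]
    have hi : inner ℝ Y (∑ i, z i • b i) = ‖Y‖ * z 0 := by
      have : Y = ‖Y‖ • b 0 := by rw [hb0, smul_smul, mul_inv_cancel₀ hYpos.ne', one_smul]
      conv_lhs => rw [this]
      simp [b.inner_eq_ite, inner_sum, real_inner_smul_left, real_inner_smul_right, mul_comm]
    simp only [hH]
    rw [hn, hi, mul_div_mul_left _ _ hYpos.ne']

/-- The law of `⟨x, y⟩` for `x` uniform on the power sphere, up to a normalizing constant. -/
lemma lintegral_inner_sphereUniform (j : ℕ) {P : ℝ} (hP : 0 < P) (y : Fin (j + 3) → ℝ)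
    (hy : 0 < ∑ i, y i ^ 2) :
    ∃ C : ℝ≥0∞, C ≠ 0 ∧ C ≠ ⊤ ∧ ∀ G : ℝ → ℝ≥0∞, Measurable G →
      ∫⁻ x, G (∑ i, x i * y i) ∂(sphereUniform (j + 3) P) =
        C * ∫⁻ t in Set.Ioo (-1 : ℝ) 1,
          G (√((j + 3 : ℕ) * P) * √(∑ i, y i ^ 2) * t) * ENNReal.ofReal (√(1 - t ^ 2) ^ j) := by
  set C : ℝ≥0∞ := ENNReal.ofReal (√(2 * π))⁻¹ *
        ∫⁻ v, ENNReal.ofReal (√(∑ i, v i ^ 2)) ∂(_root_.stdGaussian (j + 2)) with hC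
  have hmass : C * ∫⁻ t in Set.Ioo (-1 : ℝ) 1, 1 * ENNReal.ofReal (√(1 - t ^ 2) ^ j) = 1 := by
    rw [← lintegral_cosine_stdGaussian j (fun _ => 1) measurable_const]
    simp
  have hpos : ∫⁻ t in Set.Ioo (-1 : ℝ) 1, 1 * ENNReal.ofReal (√(1 - t ^ 2) ^ j) ≠ 0 := by
    intro h0
    rw [h0, mul_zero] at hmass
    exact zero_ne_one hmass
  refine ⟨C, ?_, ?_, fun G hG => ?_⟩
  · intro h0
    rw [h0, zero_mul] at hmass
    exact zero_ne_one hmass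
  · intro h0
    rw [h0, ENNReal.top_mul hpos] at hmass
    exact ENNReal.one_ne_top hmass.symm
  · have hs := sqrt_pos.2 hy
    set κ := √((j + 3 : ℕ) * P) * √(∑ i, y i ^ 2) with hκ
    have h1 := lintegral_inner_stdGaussian (j + 2) y hy (fun t => G (κ * t)) (by fun_prop)
    rw [lintegral_cosine_stdGaussian j (fun t => G (κ * t)) (by fun_prop)] at h1
    rw [← h1]
    unfold sphereUniform
    rw [lintegral_map (by fun_prop) (by fun_prop)]
    refine lintegral_congr fun z => ?_
    congr 1
    simp only [Pi.smul_apply, smul_eq_mul, mul_assoc, ← Finset.mul_sum, hκ]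
    field_simp

/-- A bound on the posterior probability of a slab from pointwise bounds on the density of the
cosine of the angle between `x` and `y`. -/
lemma posterior_toReal_le (j : ℕ) {P : ℝ} (hP : 0 < P) (y : Fin (j + 3) → ℝ)
    (hy : 0 < ∑ i, y i ^ 2) {κ t₀ w F e : ℝ}
    (hκ : κ = √((j + 3 : ℕ) * P) * √(∑ i, y i ^ 2)) (hw : 0 < w) (hF : 0 < F) (he : 0 < e)
    (hup : ∀ t ∈ Set.Ioo (-1 : ℝ) 1, √(1 - t ^ 2) ^ j * exp (κ * t) ≤ F)
    (hlow : ∀ t ∈ Set.Icc (t₀ - w) (t₀ + w),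
      t ∈ Set.Ioo (-1 : ℝ) 1 ∧ F * e ≤ √(1 - t ^ 2) ^ j * exp (κ * t))
    (a : ℝ) {μ : ℝ} (hμ : 0 < μ) :
    (_root_.posterior (j + 3) P y {x | (∑ i, x i ^ 2) = (j + 3 : ℕ) * P ∧
      (∑ i, x i * y i) ∈ Set.Icc a (a + μ)}).toReal ≤ μ / κ / (e * (2 * w)) := by
  have hκ0 : 0 < κ := by
    rw [hκ]
    have := sqrt_pos.2 hy
    positivity
  obtain ⟨C, hC0, hCt, hC⟩ := lintegral_inner_sphereUniform j hP y hy
  rw [← hκ] at hC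
  set S : Set (Fin (j + 3) → ℝ) := {x | (∑ i, x i * y i) ∈ Set.Icc a (a + μ)} with hS
  have hSm : MeasurableSet S :=
    measurableSet_Icc.preimage (f := fun x : Fin (j + 3) → ℝ => ∑ i, x i * y i) (by fun_prop)
  set G : ℝ → ℝ≥0∞ := (Set.Icc a (a + μ)).indicator fun u => ENNReal.ofReal (exp u) with hG
  have hGm : Measurable G := Measurable.indicator (by fun_prop) measurableSet_Icc
  have hnum : ∫⁻ x in S, ENNReal.ofReal (exp (∑ i, x i * y i)) ∂(sphereUniform (j + 3) P) =
      ∫⁻ x, G (∑ i, x i * y i) ∂(sphereUniform (j + 3) P) := by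
    rw [← lintegral_indicator hSm]
    rfl
  have hI : ∫⁻ t in Set.Ioo (-1 : ℝ) 1, G (κ * t) * ENNReal.ofReal (√(1 - t ^ 2) ^ j) ≤
      ENNReal.ofReal (F * (μ / κ)) := by
    calc ∫⁻ t in Set.Ioo (-1 : ℝ) 1, G (κ * t) * ENNReal.ofReal (√(1 - t ^ 2) ^ j)
        ≤ ∫⁻ t in Set.Ioo (-1 : ℝ) 1,
            (Set.Icc (a / κ) ((a + μ) / κ)).indicator (fun _ => ENNReal.ofReal F) t := by
          refine setLIntegral_mono (measurable_const.indicator measurableSet_Icc) fun t ht => ?_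
          by_cases h : κ * t ∈ Set.Icc a (a + μ)
          · have h' : t ∈ Set.Icc (a / κ) ((a + μ) / κ) := by
              rw [Set.mem_Icc, div_le_iff₀ hκ0, le_div_iff₀ hκ0, mul_comm t]
              exact h
            rw [hG, Set.indicator_of_mem h, Set.indicator_of_mem h',
              ← ENNReal.ofReal_mul (exp_pos _).le, mul_comm]
            exact ENNReal.ofReal_le_ofReal (hup t ht)
          · rw [hG, Set.indicator_of_notMem h, zero_mul]
            exact zero_le
      _ ≤ ∫⁻ t, (Set.Icc (a / κ) ((a + μ) / κ)).indicator (fun _ => ENNReal.ofReal F) t :=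
          setLIntegral_le_lintegral _ _
      _ = ENNReal.ofReal (F * (μ / κ)) := by
          rw [lintegral_indicator_const measurableSet_Icc, Real.volume_Icc,
            ← ENNReal.ofReal_mul hF.le]
          congr 2
          ring
  have hZ : ENNReal.ofReal (F * e * (2 * w)) ≤ ∫⁻ t in Set.Ioo (-1 : ℝ) 1,
      ENNReal.ofReal (exp (κ * t)) * ENNReal.ofReal (√(1 - t ^ 2) ^ j) := by
    calc ENNReal.ofReal (F * e * (2 * w))
        = ∫⁻ _ in Set.Icc (t₀ - w) (t₀ + w), ENNReal.ofReal (F * e) := by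
          rw [setLIntegral_const, Real.volume_Icc, ← ENNReal.ofReal_mul (by positivity)]
          congr 2
          ring
      _ ≤ ∫⁻ t in Set.Icc (t₀ - w) (t₀ + w),
            ENNReal.ofReal (exp (κ * t)) * ENNReal.ofReal (√(1 - t ^ 2) ^ j) := by
          refine setLIntegral_mono (by fun_prop) fun t ht => ?_
          rw [← ENNReal.ofReal_mul (exp_pos _).le, mul_comm (exp _)]
          exact ENNReal.ofReal_le_ofReal (hlow t ht).2
      _ ≤ _ := lintegral_mono_set fun t ht => (hlow t ht).1
  refine ENNReal.toReal_le_of_le_ofReal (by positivity) ?_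
  calc _root_.posterior (j + 3) P y {x | (∑ i, x i ^ 2) = (j + 3 : ℕ) * P ∧
      (∑ i, x i * y i) ∈ Set.Icc a (a + μ)}
      ≤ _root_.posterior (j + 3) P y S := measure_mono fun x hx => hx.2
    _ = (C * ∫⁻ t in Set.Ioo (-1 : ℝ) 1, G (κ * t) * ENNReal.ofReal (√(1 - t ^ 2) ^ j)) /
        (C * ∫⁻ t in Set.Ioo (-1 : ℝ) 1,
          ENNReal.ofReal (exp (κ * t)) * ENNReal.ofReal (√(1 - t ^ 2) ^ j)) := by
        rw [_root_.posterior, Measure.smul_apply, withDensity_apply _ hSm, hnum, hC G hGm,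
          hC (fun u => ENNReal.ofReal (exp u)) (by fun_prop), smul_eq_mul, mul_comm,
          ← div_eq_mul_inv]
    _ = _ := ENNReal.mul_div_mul_left _ _ hC0 hCt
    _ ≤ ENNReal.ofReal (F * (μ / κ)) / ENNReal.ofReal (F * e * (2 * w)) :=
        ENNReal.div_le_div hI hZ
    _ = ENNReal.ofReal (μ / κ / (e * (2 * w))) := by
        rw [← ENNReal.ofReal_div_of_pos (by positivity)]
        congr 1
        field_simp

/-- A second-order lower bound for `1 - x`. -/
lemma exp_le_one_sub {x : ℝ} (hx : |x| ≤ 1 / 2) :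
    exp (-x - x ^ 2 / 2 - 2 * |x| ^ 3) ≤ 1 - x := by
  have hx1 : |x| < 1 := by linarith
  have hlt : 0 < 1 - x := by linarith [le_abs_self x]
  have h := abs_log_sub_add_sum_range_le hx1 2
  have h2 : |x| ^ 3 / (1 - |x|) ≤ 2 * |x| ^ 3 := by
    rw [div_le_iff₀ (by linarith)]
    nlinarith [pow_nonneg (abs_nonneg x) 3]
  simp only [Finset.sum_range_succ, Finset.sum_range_zero] at h
  norm_num at h
  rw [← le_log_iff_exp_le hlt]
  linarith [(abs_le.1 h).1]

/-- Pointwise bounds around its maximum for the log-concave density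
`√(1 - t²) ^ j * exp (κ t)`, with `κ = j b / 2`. -/
lemma cosine_density_bounds (j : ℕ) {b κ D t₀ w : ℝ} (hb : 0 < b) (hκ : κ = j * b / 2)
    (hD : D = 2 / (√(1 + b ^ 2) + 1)) (ht₀ : t₀ = b * D / 2) (hw : 0 < w)
    (hsmall : w * (b + w / D) ≤ 1 / 2) :
    (∀ t ∈ Set.Ioo (-1 : ℝ) 1, √(1 - t ^ 2) ^ j * exp (κ * t) ≤ √D ^ j * exp (κ * t₀)) ∧
    ∀ t ∈ Set.Icc (t₀ - w) (t₀ + w), t ∈ Set.Ioo (-1 : ℝ) 1 ∧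
      √D ^ j * exp (κ * t₀) * exp (-(j / 2 * w ^ 2 *
        (1 / D + (b + w / D) ^ 2 / 2 + 2 * w * (b + w / D) ^ 3))) ≤
        √(1 - t ^ 2) ^ j * exp (κ * t) := by
  have hR : 0 < √(1 + b ^ 2) := by positivity
  have hD0 : 0 < D := by rw [hD]; positivity
  have hDt : 1 - t₀ ^ 2 = D := by
    have h2 : √(1 + b ^ 2) ^ 2 = 1 + b ^ 2 := sq_sqrt (by positivity)
    rw [ht₀, hD]
    field_simp
    nlinarith
  have hfac : ∀ t, 1 - t ^ 2 = D * (1 - (b * (t - t₀) + (t - t₀) ^ 2 / D)) := by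
    intro t
    have h1 : D * (1 - (b * (t - t₀) + (t - t₀) ^ 2 / D)) =
        D - b * D * (t - t₀) - (t - t₀) ^ 2 := by field_simp; ring
    have h2 : b * D = 2 * t₀ := by rw [ht₀]; ring
    rw [h1, h2, ← hDt]
    ring
  have hsqrt : ∀ t, √(1 - t ^ 2) ^ j * exp (κ * t) = √D ^ j * exp (κ * t₀) *
      (√(1 - (b * (t - t₀) + (t - t₀) ^ 2 / D)) ^ j * exp (κ * (t - t₀))) := by
    intro t
    have : κ * t = κ * t₀ + κ * (t - t₀) := by ring
    rw [hfac t, sqrt_mul hD0.le, mul_pow, this, exp_add]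
    ring
  have hexp : ∀ z, √(exp z) ^ j = exp (j * (z / 2)) := by
    intro z
    rw [← exp_half, ← exp_nat_mul]
  constructor
  · intro t ht
    rw [hsqrt t]
    refine mul_le_of_le_one_right (by positivity) ?_
    set u := t - t₀ with hu
    calc √(1 - (b * u + u ^ 2 / D)) ^ j * exp (κ * u)
        ≤ √(exp (-(b * u + u ^ 2 / D))) ^ j * exp (κ * u) := by
          gcongr
          exact one_sub_le_exp_neg _
      _ = exp (-(j * (u ^ 2 / D) / 2)) := by
          rw [hexp, ← exp_add, hκ]
          congr 1
          ring
      _ ≤ 1 := exp_le_one_iff.2 (by rw [neg_nonpos]; positivity)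
  · intro t ht
    set u := t - t₀ with hu
    set x := b * u + u ^ 2 / D with hx
    have huw : |u| ≤ w := abs_le.2 ⟨by linarith [ht.1], by linarith [ht.2]⟩
    have hxu : |x| ≤ |u| * (b + w / D) := by
      calc |x| ≤ |b * u| + |u ^ 2 / D| := abs_add_le _ _
        _ = |u| * (b + |u| / D) := by
            rw [abs_mul, abs_of_pos hb, abs_div, abs_of_pos hD0, abs_pow]
            ring
        _ ≤ |u| * (b + w / D) := by gcongr
    have hB : 0 < b + w / D := by positivity
    have hx2 : |x| ≤ 1 / 2 := by
      refine hxu.trans (le_trans ?_ hsmall)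
      gcongr
    have hx1 : 0 < 1 - x := by linarith [le_abs_self x]
    have ht1 : t ∈ Set.Ioo (-1 : ℝ) 1 := by
      have h1 : 0 < 1 - t ^ 2 := by rw [hfac t]; positivity
      exact abs_lt.1 ((sq_lt_one_iff_abs_lt_one t).1 (by linarith))
    refine ⟨ht1, ?_⟩
    rw [hsqrt t]
    gcongr
    calc exp (-(j / 2 * w ^ 2 * (1 / D + (b + w / D) ^ 2 / 2 + 2 * w * (b + w / D) ^ 3)))
        ≤ exp (j * ((-x - x ^ 2 / 2 - 2 * |x| ^ 3) / 2) + κ * u) := by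
          rw [exp_le_exp, hκ]
          have h1 : x ^ 2 ≤ w ^ 2 * (b + w / D) ^ 2 := by
            rw [← sq_abs, ← mul_pow]
            gcongr
            exact hxu.trans (by gcongr)
          have h2 : |x| ^ 3 ≤ w ^ 3 * (b + w / D) ^ 3 := by
            rw [← mul_pow]
            gcongr
            exact hxu.trans (by gcongr)
          have h3 : u ^ 2 / D ≤ w ^ 2 / D := by
            rw [← sq_abs u]
            gcongr
          have h4 : u ^ 2 / D + x ^ 2 / 2 + 2 * |x| ^ 3 ≤
              w ^ 2 * (1 / D + (b + w / D) ^ 2 / 2 + 2 * w * (b + w / D) ^ 3) := by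
            have : w ^ 2 * (1 / D + (b + w / D) ^ 2 / 2 + 2 * w * (b + w / D) ^ 3) =
              w ^ 2 / D + w ^ 2 * (b + w / D) ^ 2 / 2 + 2 * (w ^ 3 * (b + w / D) ^ 3) := by ring
            rw [this]
            linarith
          have h5 := mul_le_mul_of_nonneg_left h4 (by positivity : (0 : ℝ) ≤ j / 2)
          have h6 : j * ((-x - x ^ 2 / 2 - 2 * |x| ^ 3) / 2) + j * b / 2 * u =
              -(j / 2 * (u ^ 2 / D + x ^ 2 / 2 + 2 * |x| ^ 3)) := by
            have : b * u = x - u ^ 2 / D := by rw [hx]; ring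
            linear_combination (j / 2 : ℝ) * this
          rw [h6]
          linarith
      _ = √(exp (-x - x ^ 2 / 2 - 2 * |x| ^ 3)) ^ j * exp (κ * u) := by
          rw [hexp, ← exp_add]
      _ ≤ √(1 - x) ^ j * exp (κ * u) := by
          gcongr
          exact exp_le_one_sub hx2

/-- The value of `L` at `s = P + 1`, where `√(1 + 4 P s) = 2 P + 1`. -/
lemma L_add_one {P : ℝ} (hP : 0 < P) :
    L P (P + 1) = (P + 1) ^ 2 * √(2 * P + 1) / √(2 * π) := by
  have h1 : √(1 + 4 * P * (P + 1)) = 2 * P + 1 := by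
    rw [show 1 + 4 * P * (P + 1) = (2 * P + 1) ^ 2 by ring, sqrt_sq (by positivity)]
  have h2 : (1 + 4 * P * (P + 1) - (2 * P + 1)) / (2 * P + 1 - 1) ^ 5 =
      (2 * P + 1) / ((2 * P) ^ 2) ^ 2 := by
    rw [show 2 * P + 1 - 1 = 2 * P by ring]
    field_simp
    ring
  rw [L, h1, h2, sqrt_div' _ (by positivity), sqrt_sq (by positivity)]
  field_simp

/-- Near the typical regime `s = P + 1`, `n / (n - 3) = 1`, `w = 0`, the curvature term of
`cosine_density_bounds` is close to `(2 P + 1) (P + 1)`. -/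
lemma exists_typical_radius {P : ℝ} (hP : 0 < P) :
    ∃ δ > 0, ∀ s c w b D : ℝ, |s - (P + 1)| < δ → |c - 1| < δ → |w| < δ →
      b = 2 * c * √(P * s) → D = 2 / (√(1 + b ^ 2) + 1) →
      1 / D + (b + w / D) ^ 2 / 2 + 2 * w * (b + w / D) ^ 3 ≤
          6 / 5 * ((2 * P + 1) * (P + 1)) ∧
        w * (b + w / D) ≤ 1 / 2 ∧ 16 / 25 * (P + 1) ≤ s := by
  set B : ℝ × ℝ × ℝ → ℝ := fun p => 2 * p.2.1 * √(P * p.1) with hB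
  set E : ℝ × ℝ × ℝ → ℝ := fun p => (√(1 + B p ^ 2) + 1) / 2 with hE
  have hBc : Continuous B := by fun_prop
  have hEc : Continuous E := by fun_prop
  have hB0 : B (P + 1, 1, 0) ^ 2 = 4 * P * (P + 1) := by
    simp only [hB]
    rw [mul_pow, sq_sqrt (by positivity)]
    ring
  have hE0 : E (P + 1, 1, 0) = P + 1 := by
    simp only [hE]
    rw [hB0, show 1 + 4 * P * (P + 1) = (2 * P + 1) ^ 2 by ring, sqrt_sq (by positivity)]
    ring
  have h1 : ∀ᶠ p in nhds ((P + 1, 1, 0) : ℝ × ℝ × ℝ),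
      E p + (B p + p.2.2 * E p) ^ 2 / 2 + 2 * p.2.2 * (B p + p.2.2 * E p) ^ 3 <
        6 / 5 * ((2 * P + 1) * (P + 1)) := by
    refine ContinuousAt.eventually_lt (by fun_prop) continuousAt_const ?_
    simp only [mul_zero, zero_mul, add_zero]
    rw [hB0, hE0]
    nlinarith
  have h2 : ∀ᶠ p in nhds ((P + 1, 1, 0) : ℝ × ℝ × ℝ), p.2.2 * (B p + p.2.2 * E p) < 1 / 2 :=
    ContinuousAt.eventually_lt (by fun_prop) continuousAt_const (by norm_num)
  have h3 : ∀ᶠ p in nhds ((P + 1, 1, 0) : ℝ × ℝ × ℝ), 16 / 25 * (P + 1) < p.1 :=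
    ContinuousAt.eventually_lt continuousAt_const (by fun_prop) (by simp only; linarith)
  obtain ⟨δ, hδ, hball⟩ := Metric.eventually_nhds_iff.1 (h1.and (h2.and h3))
  refine ⟨δ, hδ, fun s c w b D hs hc hw hb hD => ?_⟩
  have hmem : dist (s, c, w) ((P + 1, 1, 0) : ℝ × ℝ × ℝ) < δ := by
    simp only [Prod.dist_eq, Real.dist_eq, sub_zero, max_lt_iff]
    exact ⟨hs, hc, hw⟩
  obtain ⟨g1, g2, g3⟩ := hball hmem
  have hBb : B (s, c, w) = b := hb.symm
  have hEb : E (s, c, w) = 1 / D := by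
    simp only [hE]
    rw [hBb, hD, one_div_div]
  simp only [hBb, hEb, mul_one_div] at g1 g2 g3
  exact ⟨g1.le, g2.le, g3.le⟩

lemma exp_mul_sqrt_two_pi_le : exp (3 / 5) * √(2 * π) ≤ 24 / 5 := by
  have h1 : exp (3 / 5) ≤ 1.85 := by
    refine le_of_pow_le_pow_left₀ (n := 5) (by norm_num) (by norm_num) ?_
    rw [← exp_nat_mul, show ((5 : ℕ) : ℝ) * (3 / 5) = (3 : ℕ) * 1 by norm_num, exp_nat_mul]
    calc exp 1 ^ 3 ≤ 2.7182818286 ^ 3 := by gcongr; exact exp_one_lt_d9.le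
      _ ≤ 1.85 ^ 5 := by norm_num
  have h2 : √(2 * π) ≤ 2.51 := by
    rw [sqrt_le_left (by norm_num)]
    linarith [pi_lt_d2]
  calc exp (3 / 5) * √(2 * π) ≤ 1.85 * 2.51 := by gcongr
    _ ≤ 24 / 5 := by norm_num

/-- Comparison of the bound of `posterior_toReal_le` with the constant `3 L(P, P+1)`. -/
lemma posterior_constant_le {P s m μ e : ℝ} (hP : 0 < P) (hm : 0 < m) (hμ : 0 < μ)
    (hs : 16 / 25 * (P + 1) ≤ s) (he : exp (-(3 / 5)) ≤ e) :
    μ / (m * √(P * s)) / (e * (2 * (1 / √(m * ((2 * P + 1) * (P + 1)))))) ≤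
      3 * L P (P + 1) / √(P * (P + 1)) * μ / √m := by
  have hs0 : 0 < s := by linarith
  have hsq : 4 / 5 * √(P + 1) ≤ √s := by
    rw [le_sqrt (by positivity) hs0.le, mul_pow, sq_sqrt (by positivity)]
    linarith
  have hA := sqrt_pos.2 (by linarith : 0 < P + 1)
  have hB := sqrt_pos.2 (by linarith : 0 < 2 * P + 1)
  have hC := sqrt_pos.2 hP
  have hD := sqrt_pos.2 hm
  have hE := sqrt_pos.2 hs0
  have hF : 0 < √(2 * π) := by positivity
  have hmm : m = √m ^ 2 := (sq_sqrt hm.le).symm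
  have hAA : √(P + 1) ^ 2 = P + 1 := sq_sqrt (by positivity)
  have hkey : exp (3 / 5) * √(2 * π) * (P + 1) ≤ 6 * (P + 1) ^ 2 * √s := by
    have h1 : 4 / 5 ≤ √s := by
      have : 1 ≤ √(P + 1) := one_le_sqrt.2 (by linarith)
      linarith
    calc exp (3 / 5) * √(2 * π) * (P + 1) ≤ 24 / 5 * (P + 1) := by
          gcongr
          exact exp_mul_sqrt_two_pi_le
      _ = 6 * ((P + 1) * 1) * (4 / 5) := by ring
      _ ≤ 6 * ((P + 1) * (P + 1)) * √s := by
          gcongr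
          linarith
      _ = 6 * (P + 1) ^ 2 * √s := by ring
  calc μ / (m * √(P * s)) / (e * (2 * (1 / √(m * ((2 * P + 1) * (P + 1))))))
      ≤ μ / (m * √(P * s)) / (exp (-(3 / 5)) * (2 * (1 / √(m * ((2 * P + 1) * (P + 1)))))) := by
        gcongr
    _ = exp (3 / 5) * (P + 1) *
          (μ * √(2 * P + 1) / (2 * √m * √P * √s * √(P + 1))) := by
        rw [sqrt_mul hm.le, sqrt_mul (by positivity : 0 ≤ 2 * P + 1), sqrt_mul hP.le, exp_neg]
        field_simp
        rw [hAA, ← hmm]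
    _ ≤ 6 * (P + 1) ^ 2 * √s / √(2 * π) *
          (μ * √(2 * P + 1) / (2 * √m * √P * √s * √(P + 1))) := by
        gcongr
        rw [le_div_iff₀ hF]
        linarith
    _ = 3 * L P (P + 1) / √(P * (P + 1)) * μ / √m := by
        rw [L_add_one hP, sqrt_mul hP.le]
        field_simp
        norm_num

/-- For any typical output `y` (i.e. `(1/n)‖y‖₂² ∈ [P+1-n^{-1/3}, P+1+n^{-1/3}]`), the
posterior probability that `⟨x, y⟩` lies in an interval of length `μ` is at most
`K(P) μ / √n` where `K(P) = 3 L(P, P+1)/√(P(P+1))`, for all sufficiently large `n`. -/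
theorem posterior_interval_bound (P : ℝ) (hP : 0 < P) :
    ∃ N : ℕ, ∀ n : ℕ, n ≥ N → ∀ y : Fin n → ℝ,
      (1 / n : ℝ) * ∑ i, y i ^ 2 ∈
          Set.Icc (P + 1 - (n : ℝ) ^ (-(1 / 3) : ℝ)) (P + 1 + (n : ℝ) ^ (-(1 / 3) : ℝ)) →
      ∀ a μ : ℝ, 0 < μ →
        (posterior n P y {x | (∑ i, x i ^ 2) = n * P ∧
            (∑ i, x i * y i) ∈ Set.Icc a (a + μ)}).toReal
          ≤ 3 * L P (P + 1) / Real.sqrt (P * (P + 1)) * μ / Real.sqrt n := by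
  obtain ⟨δ, hδ, hrad⟩ := exists_typical_radius hP
  set A : ℝ := (2 * P + 1) * (P + 1) with hA
  have hA0 : 0 < A := by positivity
  have hcast : Filter.Tendsto (fun j : ℕ => ((j + 3 : ℕ) : ℝ)) Filter.atTop Filter.atTop :=
    tendsto_natCast_atTop_atTop.comp (Filter.tendsto_add_atTop_nat 3)
  have e1 : ∀ᶠ j : ℕ in Filter.atTop, ((j + 3 : ℕ) : ℝ) ^ (-(1 / 3) : ℝ) < δ :=
    ((tendsto_rpow_neg_atTop (by norm_num : (0 : ℝ) < 1 / 3)).comp hcast).eventually_lt_const hδ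
  have e2 : ∀ᶠ j : ℕ in Filter.atTop, 1 / √((j + 3 : ℕ) * A) < δ := by
    have : Filter.Tendsto (fun j : ℕ => 1 / √((j + 3 : ℕ) * A)) Filter.atTop (nhds 0) := by
      refine Filter.Tendsto.div_atTop tendsto_const_nhds ?_
      exact tendsto_sqrt_atTop.comp (hcast.atTop_mul_const hA0)
    exact this.eventually_lt_const hδ
  have e3 : ∀ᶠ j : ℕ in Filter.atTop, 3 / (j : ℝ) < δ :=
    (tendsto_const_div_atTop_nhds_zero_nat 3).eventually_lt_const hδ
  obtain ⟨J, hJ⟩ := Filter.eventually_atTop.1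
    (e1.and (e2.and (e3.and (Filter.eventually_ge_atTop 1))))
  refine ⟨J + 3, fun n hn y hy a μ hμ => ?_⟩
  obtain ⟨j, rfl⟩ : ∃ j, n = j + 3 := ⟨n - 3, by omega⟩
  obtain ⟨hj1, hj2, hj3, hj4⟩ := hJ j (by omega)
  have hj : (0 : ℝ) < j := by exact_mod_cast hj4
  have hm : ((j + 3 : ℕ) : ℝ) = j + 3 := by push_cast; rfl
  set m : ℝ := ((j + 3 : ℕ) : ℝ) with hmdef
  have hm0 : 0 < m := by rw [hm]; positivity
  set s : ℝ := 1 / m * ∑ i, y i ^ 2 with hs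
  have hys : ∑ i, y i ^ 2 = m * s := by rw [hs]; field_simp
  set w : ℝ := 1 / √(m * A) with hw
  have hw0 : 0 < w := by positivity
  set b : ℝ := 2 * (m / j) * √(P * s) with hb
  set D : ℝ := 2 / (√(1 + b ^ 2) + 1) with hD
  have hs1 : |s - (P + 1)| < δ :=
    abs_lt.2 ⟨by linarith [hy.1], by linarith [hy.2]⟩
  have hc1 : |m / j - 1| < δ := by
    have : m / j - 1 = 3 / j := by rw [hm]; field_simp; ring
    rwa [this, abs_of_pos (by positivity)]
  obtain ⟨hcurv, hsmall, hslow⟩ :=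
    hrad s (m / j) w b D hs1 hc1 (by rwa [abs_of_pos hw0]) hb hD
  have hs0 : 0 < s := by linarith
  have hb0 : 0 < b := by positivity
  have hκ : m * √(P * s) = √(m * P) * √(∑ i, y i ^ 2) := by
    rw [hys, ← sqrt_mul (by positivity), show m * P * (m * s) = m ^ 2 * (P * s) by ring,
      sqrt_mul (sq_nonneg m), sqrt_sq hm0.le]
  have hκb : m * √(P * s) = j * b / 2 := by rw [hb]; field_simp
  obtain ⟨hup, hlow⟩ := cosine_density_bounds j hb0 hκb hD rfl hw0 hsmall
  have hD0 : 0 < D := by positivity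
  have hmain := posterior_toReal_le j hP y (by rw [hys]; positivity) hκ hw0 (by positivity)
    (exp_pos _) hup hlow a hμ
  refine hmain.trans (posterior_constant_le hP hm0 hμ hslow ?_)
  rw [exp_le_exp, neg_le_neg_iff]
  have hww : w ^ 2 = 1 / (m * A) := by rw [hw, div_pow, one_pow, sq_sqrt (by positivity)]
  calc j / 2 * w ^ 2 * (1 / D + (b + w / D) ^ 2 / 2 + 2 * w * (b + w / D) ^ 3)
      ≤ m / 2 * w ^ 2 * (6 / 5 * A) := by
        gcongr
        linarith
    _ = 3 / 5 := by rw [hww]; field_simp; norm_num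

end
end
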